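/- arXiv:2106.07416 — 3 statements merged into one kernel-verified Lean document; each statement's English description precedes it below -/
import Mathlib

section
/- Let α ∈ (1,2) and β > 0. For every μ ∈ ℝ with πα/2 < μ < π there exists a constant C = C(α, β, μ) > 0 such that for all z ∈ ℂ with μ ≤ |arg(z)| ≤ π one has |E_{α,β}(z)| ≤ C/(1 + |z|). -/
/-- The Mittag-Leffler function `E_{α,β}(z) = ∑_{k=0}^∞ z^k / Γ(αk + β)`, `z ∈ ℂ`. -/
noncomputable def mittagLefflerC (α β : ℝ) (z : ℂ) : ℂ :=
  ∑' k : ℕ, z ^ k / Complex.Gamma ((α * (k : ℝ) + β : ℝ) : ℂ)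

open Complex

lemma norm_Gamma_half (y : ℝ) : ‖Gamma (1/2 + y * I)‖^2 = Real.pi / Real.cosh (Real.pi * y) := by
  have h := Gamma_mul_Gamma_one_sub (1/2 + y * I)
  have h1 : (1:ℂ) - (1/2 + y * I) = (starRingEnd ℂ) (1/2 + y * I) := by
    apply Complex.ext <;> simp <;> norm_num
  have h2 : Complex.sin (Real.pi * (1/2 + y * I)) = (Real.cosh (Real.pi * y) : ℝ) := by
    rw [show (Real.pi * (1/2 + y * I) : ℂ) = Real.pi * y * I + Real.pi / 2 by ring,
      Complex.sin_add_pi_div_two, Complex.cos_mul_I]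
    push_cast; rfl
  rw [h1, Gamma_conj, mul_conj, h2] at h
  rw [← Complex.normSq_eq_norm_sq]
  exact_mod_cast h

lemma cosh_le_exp_abs (y : ℝ) : Real.cosh y ≤ Real.exp |y| := by
  rw [← Real.cosh_abs, Real.cosh_eq]
  have : Real.exp (-|y|) ≤ Real.exp |y| := Real.exp_le_exp.2 (by linarith [abs_nonneg y])
  linarith

lemma norm_beta_le (y d : ℝ) (hd : 0 < d) :
    ‖betaIntegral (1/2 + y * I) d‖ ≤ Real.Gamma (1/2) * Real.Gamma d / Real.Gamma (1/2 + d) := by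
  have h := Gamma_mul_Gamma_eq_betaIntegral (s := 1/2) (t := d) (by norm_num) (by simpa using hd)
  have hG : Real.Gamma (1/2 + d) ≠ 0 := (Real.Gamma_pos_of_pos (by linarith)).ne'
  have hB : betaIntegral (1/2) d
      = ((Real.Gamma (1/2) * Real.Gamma d / Real.Gamma (1/2 + d) : ℝ) : ℂ) := by
    push_cast
    rw [eq_div_iff (by exact_mod_cast hG)]
    rw [← Complex.Gamma_ofReal, ← Complex.Gamma_ofReal, ← Complex.Gamma_ofReal]
    push_cast
    rw [h]; ring
  have hR : betaIntegral (1/2) d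
      = ((∫ x in (0:ℝ)..1, ‖(x : ℂ) ^ ((1/2 + y * I : ℂ) - 1) * (1 - (x : ℂ)) ^ ((d : ℂ) - 1)‖ : ℝ) : ℂ) := by
    rw [betaIntegral, ← intervalIntegral.integral_ofReal]
    refine intervalIntegral.integral_congr_ae ?_
    have : ∀ᵐ x : ℝ, x ≠ 1 := by simp [MeasureTheory.ae_iff]
    filter_upwards [this] with x hx1 hx
    rw [Set.uIoc_of_le zero_le_one] at hx
    have hx0 : 0 < x := hx.1
    have hx1' : 0 < 1 - x := by
      have := lt_of_le_of_ne hx.2 hx1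
      linarith
    rw [norm_mul, Complex.norm_cpow_eq_rpow_re_of_pos hx0]
    rw [show (1 - (x:ℂ)) = ((1 - x : ℝ) : ℂ) by push_cast; rfl]
    rw [Complex.norm_cpow_eq_rpow_re_of_pos hx1']
    push_cast
    rw [Complex.ofReal_cpow hx0.le, Complex.ofReal_cpow hx1'.le]
    simp
  have e : (∫ x in (0:ℝ)..1, ‖(x : ℂ) ^ ((1/2 + y * I : ℂ) - 1) * (1 - (x : ℂ)) ^ ((d : ℂ) - 1)‖)
      = Real.Gamma (1/2) * Real.Gamma d / Real.Gamma (1/2 + d) := by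
    have := hR.symm.trans hB
    exact_mod_cast this
  rw [← e]
  exact intervalIntegral.norm_integral_le_integral_norm zero_le_one

lemma inv_Gamma_le (x y : ℝ) (hx : 1/2 < x) :
    ‖(Gamma (x + y * I))⁻¹‖ ≤ Real.exp (Real.pi / 2 * |y|) / Real.Gamma x := by
  have hd : 0 < x - 1/2 := by linarith
  have h := Gamma_mul_Gamma_eq_betaIntegral (s := 1/2 + y * I) (t := ((x - 1/2 : ℝ) : ℂ))
    (by simp) (by rw [ofReal_re]; exact hd)
  rw [show (1/2 + y * I + ((x - 1/2 : ℝ) : ℂ)) = x + y * I by push_cast; ring] at h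
  have h2 := congrArg norm h
  rw [norm_mul, norm_mul, Complex.Gamma_ofReal, norm_real, Real.norm_of_nonneg
    (Real.Gamma_pos_of_pos hd).le] at h2
  have h3 := norm_beta_le y (x - 1/2) hd
  rw [show 1/2 + (x - 1/2) = x by ring] at h3
  have hg := norm_Gamma_half y
  have hGd := Real.Gamma_pos_of_pos hd
  have hGx : 0 < Real.Gamma x := Real.Gamma_pos_of_pos (by linarith)
  set G := ‖Gamma (x + y * I)‖ with hGdef
  have hG0 : 0 ≤ G := norm_nonneg _
  have hGh : 0 < Real.Gamma (1/2) := Real.Gamma_pos_of_pos (by norm_num)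
  have hGh2 : Real.Gamma (1/2) ^ 2 = Real.pi := by
    rw [Real.Gamma_one_half_eq, Real.sq_sqrt Real.pi_pos.le]
  set N := ‖Gamma (1/2 + y * I)‖
  have hN0 : 0 ≤ N := norm_nonneg _
  have h4 : N * Real.Gamma x ≤ G * Real.Gamma (1/2) := by
    have : N * Real.Gamma (x - 1/2) ≤
      G * (Real.Gamma (1/2) * Real.Gamma (x - 1/2) / Real.Gamma x) := by
      rw [h2]; gcongr
    rw [mul_div_assoc', le_div_iff₀ hGx] at this
    nlinarith
  have h5 : Real.Gamma (1/2) ≤ N * Real.exp (Real.pi / 2 * |y|) := by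
    have : Real.Gamma (1/2) ^ 2 ≤ (N * Real.exp (Real.pi / 2 * |y|)) ^ 2 := by
      rw [hGh2, mul_pow, hg, ← Real.exp_nat_mul, div_mul_eq_mul_div, le_div_iff₀ (Real.cosh_pos _)]
      have := cosh_le_exp_abs (Real.pi * y)
      rw [abs_mul, abs_of_pos Real.pi_pos] at this
      rw [show ((2:ℕ):ℝ) * (Real.pi / 2 * |y|) = Real.pi * |y| by push_cast; ring]
      exact mul_le_mul_of_nonneg_left this Real.pi_pos.le
    exact le_of_sq_le_sq this (by positivity)
  have hE := Real.exp_pos (Real.pi / 2 * |y|)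
  have h6 : Real.Gamma x ≤ G * Real.exp (Real.pi / 2 * |y|) := by
    have := mul_le_mul_of_nonneg_right h4 hE.le
    have h7 := mul_le_mul_of_nonneg_left h5 hGx.le
    nlinarith
  have hGp : 0 < G := by
    by_contra hh
    have : G = 0 := by linarith
    rw [this] at h6; linarith
  rw [norm_inv, inv_eq_one_div, div_le_div_iff₀ hGp hGx]
  linarith

lemma inv_Gamma_strip (ε : ℝ) (hε : 0 < ε) (X : ℝ) (m : ℕ) :
    ∃ C : ℝ, 0 < C ∧ ∀ x y : ℝ, 1 - (m:ℝ) ≤ x → x ≤ X →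
      ‖(Gamma (x + y * I))⁻¹‖ ≤ C * Real.exp ((Real.pi / 2 + ε) * |y|) := by
  induction m generalizing ε X with
  | zero =>
    have hc : ContinuousOn (fun x : ℝ => (Real.Gamma x)⁻¹) (Set.Icc 1 X) := by
      intro x hx
      have hx0 : 0 < x := by linarith [hx.1]
      refine ((Real.differentiableAt_Gamma ?_).continuousAt.inv₀
        (Real.Gamma_pos_of_pos hx0).ne').continuousWithinAt
      intro m hm
      have : (0:ℝ) ≤ m := m.cast_nonneg
      linarith
    obtain ⟨C, hC⟩ := isCompact_Icc.exists_bound_of_continuousOn hc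
    refine ⟨max C 1, by positivity, fun x y h1 h2 => ?_⟩
    simp only [Nat.cast_zero, sub_zero] at h1
    have hG : 0 < Real.Gamma x := Real.Gamma_pos_of_pos (by linarith)
    have := hC x ⟨h1, h2⟩
    rw [Real.norm_of_nonneg (by positivity)] at this
    refine (inv_Gamma_le x y (by linarith)).trans ?_
    rw [div_eq_inv_mul]
    gcongr
    · exact this.trans (le_max_left _ _)
    · linarith
  | succ m ih =>
    obtain ⟨C, hC0, hC⟩ := ih (ε/2) (by linarith) (X+1)
    refine ⟨(|X| + m + 1 + 2/ε) * C, by positivity, fun x y h1 h2 => ?_⟩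
    push_cast at h1
    have h := hC (x+1) y (by linarith) (by linarith)
    have e : (Gamma (x + y * I))⁻¹ = (x + y * I) * (Gamma (((x+1:ℝ):ℂ) + y * I))⁻¹ := by
      have := one_div_Gamma_eq_self_mul_one_div_Gamma_add_one (x + y * I)
      rw [show (((x+1:ℝ):ℂ) + y * I) = x + y * I + 1 by push_cast; ring]
      simpa using this
    rw [e, norm_mul]
    have hn : ‖(x + y * I : ℂ)‖ ≤ (|X| + m + 1 + 2/ε) * Real.exp (ε / 2 * |y|) := by
      have a1 : ‖(x + y * I : ℂ)‖ ≤ |x| + |y| := by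
        refine (norm_add_le _ _).trans ?_
        simp
      have a2 : |x| ≤ |X| + m + 1 := by
        rw [abs_le]
        have := le_abs_self X
        have := abs_nonneg X
        have := (m.cast_nonneg : (0:ℝ) ≤ m)
        constructor <;> linarith
      have a3 : |y| ≤ 2/ε * Real.exp (ε/2*|y|) := by
        have := Real.add_one_le_exp (ε/2*|y|)
        rw [div_mul_eq_mul_div, le_div_iff₀ hε]
        linarith
      have a4 : 1 ≤ Real.exp (ε/2*|y|) := Real.one_le_exp (by positivity)
      have a5 : (|X| + m + 1) * 1 ≤ (|X| + m + 1) * Real.exp (ε/2*|y|) := by gcongr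
      linarith
    calc _ ≤ ((|X| + m + 1 + 2/ε) * Real.exp (ε / 2 * |y|)) * (C * Real.exp ((Real.pi/2 + ε/2) * |y|)) := by
          gcongr
      _ = _ := by
          rw [show (Real.pi/2+ε)*|y| = ε/2*|y| + (Real.pi/2 + ε/2) * |y| by ring, Real.exp_add]
          ring

lemma integrable_exp_abs (b : ℝ) (hb : 0 < b) :
    MeasureTheory.Integrable (fun t : ℝ => Real.exp (-(b * |t|))) := by
  have hc : 0 < min 1 (b^2/2) := by positivity
  refine (integrable_inv_one_add_sq.const_mul (min 1 (b^2/2))⁻¹).mono'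
    (by fun_prop) (Filter.Eventually.of_forall fun t => ?_)
  rw [Real.norm_of_nonneg (Real.exp_pos _).le, Real.exp_neg, ← mul_inv]
  have h := Real.quadratic_le_exp_of_nonneg (x := b * |t|) (by positivity)
  have h1 := min_le_left 1 (b^2/2)
  have h2 := min_le_right 1 (b^2/2)
  have h3 : 0 ≤ b * |t| := by positivity
  refine inv_anti₀ (by positivity) ?_
  have h4 := mul_le_mul_of_nonneg_right h2 (sq_nonneg t)
  rw [mul_pow, sq_abs] at h
  nlinarith

lemma line_shift (H : ℂ → ℂ) (C b : ℝ) (hb : 0 < b)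
    (hd : DifferentiableOn ℂ H {s | |s.re| ≤ 1/2})
    (hbd : ∀ s : ℂ, |s.re| ≤ 1/2 → 1 ≤ |s.im| → ‖H s‖ ≤ C * Real.exp (-(b * |s.im|)))
    (hi1 : MeasureTheory.Integrable (fun t : ℝ => H (1/2 + t * I)))
    (hi2 : MeasureTheory.Integrable (fun t : ℝ => H (-1/2 + t * I))) :
    ∫ t : ℝ, H (1/2 + t * I) = ∫ t : ℝ, H (-1/2 + t * I) := by
  have t1 := MeasureTheory.intervalIntegral_tendsto_integral hi1
    (Filter.tendsto_neg_atTop_atBot) (Filter.tendsto_id (α := ℝ))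
  have t2 := MeasureTheory.intervalIntegral_tendsto_integral hi2
    (Filter.tendsto_neg_atTop_atBot) (Filter.tendsto_id (α := ℝ))
  have t3 := t1.sub t2
  have hrect : ∀ T : ℝ, I * ((∫ t in (-T)..T, H (1/2 + t * I)) - ∫ t in (-T)..T, H (-1/2 + t * I))
      = (∫ x in (-1/2:ℝ)..(1/2), H (x + (T:ℂ) * I)) - ∫ x in (-1/2:ℝ)..(1/2), H (x + ((-T:ℝ):ℂ) * I) := by
    intro T
    have := integral_boundary_rect_eq_zero_of_differentiableOn H ⟨-1/2, -T⟩ ⟨1/2, T⟩ (by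
      refine hd.mono ?_
      intro s hs
      have := hs.1
      simp only [Set.mem_preimage] at this
      rw [Set.uIcc_of_le (by norm_num)] at this
      simp only [Set.mem_ofPred_eq, abs_le]
      exact ⟨by linarith [this.1], this.2⟩)
    simp only [smul_eq_mul] at this
    have e1 : ((1/2 : ℝ) : ℂ) = 1/2 := by push_cast; rfl
    have e2 : ((-1/2 : ℝ) : ℂ) = -1/2 := by push_cast; rfl
    rw [e1, e2] at this
    linear_combination this
  have hz : Filter.Tendsto (fun T : ℝ => (∫ t in (-T)..T, H (1/2 + t * I)) - ∫ t in (-T)..T, H (-1/2 + t * I))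
      Filter.atTop (nhds 0) := by
    have hb0 : Filter.Tendsto (fun T : ℝ => 2 * C * Real.exp (-(b * T))) Filter.atTop (nhds 0) := by
      have := (Real.tendsto_exp_neg_atTop_nhds_zero.comp
        (Filter.tendsto_id.const_mul_atTop hb)).const_mul (2 * C)
      simpa [Function.comp_def] using this
    refine squeeze_zero_norm' ?_ hb0
    filter_upwards [Filter.eventually_ge_atTop 1] with T hT
    have hT0 : |T| = T := abs_of_nonneg (by linarith)
    have := congrArg norm (hrect T)
    rw [norm_mul, norm_I, one_mul] at this
    rw [this]
    have key : ∀ U : ℝ, |U| = T → ‖∫ x in (-1/2:ℝ)..(1/2), H (x + (U:ℂ) * I)‖ ≤ C * Real.exp (-(b * T)) := by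
      intro U hU
      have := intervalIntegral.norm_integral_le_of_norm_le_const (a := (-1/2:ℝ)) (b := 1/2)
        (f := fun x : ℝ => H (x + (U:ℂ) * I)) (C := C * Real.exp (-(b * T))) (by
          intro x hx
          rw [Set.uIoc_of_le (by norm_num)] at hx
          have := hbd (x + (U:ℂ) * I) (by simp [abs_le]; constructor <;> linarith [hx.1, hx.2])
            (by simp [hU, hT])
          simpa [hU] using this)
      rw [show |1/2 - (-1/2:ℝ)| = 1 by norm_num, mul_one] at this
      exact this
    refine (norm_sub_le _ _).trans ?_
    have k1 := key T hT0
    have k2 := key (-T) (by rw [abs_neg, hT0])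
    linarith
  have := tendsto_nhds_unique t3 hz
  exact sub_eq_zero.1 this

lemma sin_half (t : ℝ) : Complex.sin (Real.pi * (1/2 + t * I)) = (Real.cosh (Real.pi * t) : ℝ) := by
  rw [show (Real.pi * (1/2 + t * I) : ℂ) = Real.pi * t * I + Real.pi / 2 by ring,
    Complex.sin_add_pi_div_two, Complex.cos_mul_I]
  push_cast; rfl

lemma sin_neg_half (t : ℝ) : Complex.sin (Real.pi * (-1/2 + t * I)) = -(Real.cosh (Real.pi * t) : ℝ) := by
  rw [show (Real.pi * (-1/2 + t * I) : ℂ) = Real.pi * t * I - Real.pi / 2 by ring,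
    Complex.sin_sub_pi_div_two, Complex.cos_mul_I]
  push_cast; rfl

lemma norm_sin_ge (s : ℂ) (hs : 1 ≤ |s.im|) :
    Real.exp (Real.pi * |s.im|) / 4 ≤ ‖Complex.sin (Real.pi * s)‖ := by
  have h0 : ∀ y : ℝ, 1 ≤ y → Real.exp (-(Real.pi * y)) ≤ Real.exp (Real.pi * y) / 2 := by
    intro y hy
    have h1 : (2:ℝ) ≤ Real.exp (Real.pi * y) := by
      have := Real.add_one_le_exp (Real.pi * y)
      nlinarith [Real.pi_gt_three]
    rw [Real.exp_neg]
    have : (Real.exp (Real.pi * y))⁻¹ ≤ 1 := inv_le_one_of_one_le₀ (by linarith)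
    linarith
  rw [Complex.sin, norm_div, norm_mul, norm_I, mul_one]
  have e1 : ‖Complex.exp (-(Real.pi * s) * I)‖ = Real.exp (Real.pi * s.im) := by
    rw [Complex.norm_exp]; simp
  have e2 : ‖Complex.exp ((Real.pi * s) * I)‖ = Real.exp (-(Real.pi * s.im)) := by
    rw [Complex.norm_exp]; simp
  have t1 := norm_sub_norm_le (Complex.exp (-(Real.pi * s) * I)) (Complex.exp ((Real.pi * s) * I))
  have t2 := norm_sub_norm_le (Complex.exp ((Real.pi * s) * I)) (Complex.exp (-(Real.pi * s) * I))
  rw [norm_sub_rev] at t2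
  rw [e1, e2] at t1 t2
  have : ‖(2:ℂ)‖ = 2 := by simp
  rw [this]
  rcases le_abs.1 hs with h | h
  · rw [abs_of_nonneg (by linarith)]
    have := h0 _ h
    linarith
  · rw [abs_of_nonpos (by linarith)]
    have := h0 _ h
    rw [show -(Real.pi * -s.im) = Real.pi * s.im by ring] at this
    rw [show -(Real.pi * s.im) = Real.pi * -s.im by ring] at t1 t2
    linarith

lemma inv_cosh_le (t : ℝ) : (Real.cosh (Real.pi * t))⁻¹ ≤ 2 * Real.exp (-(Real.pi * |t|)) := by
  have h : Real.exp (Real.pi * |t|) / 2 ≤ Real.cosh (Real.pi * t) := by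
    rw [← Real.cosh_abs, abs_mul, abs_of_pos Real.pi_pos, Real.cosh_eq]
    linarith [Real.exp_pos (-(Real.pi * |t|))]
  rw [Real.exp_neg]
  calc _ ≤ (Real.exp (Real.pi * |t|) / 2)⁻¹ := inv_anti₀ (by positivity) h
    _ = _ := by rw [inv_div]; rfl

lemma cosh_bound (f : ℝ → ℂ) (C a : ℝ) 
    (hb : ∀ t, ‖f t‖ ≤ C * Real.exp (a * |t|)) (t : ℝ) :
    ‖f t / (Real.cosh (Real.pi * t) : ℝ)‖ ≤ 2 * C * Real.exp (-((Real.pi - a) * |t|)) := by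
  rw [norm_div, norm_real, Real.norm_of_nonneg (Real.cosh_pos _).le, div_eq_mul_inv]
  calc _ ≤ (C * Real.exp (a * |t|)) * (2 * Real.exp (-(Real.pi * |t|))) :=
        mul_le_mul (hb t) (inv_cosh_le t) (by have := Real.cosh_pos (Real.pi * t); positivity)
          ((norm_nonneg _).trans (hb t))
    _ = _ := by
        rw [show -((Real.pi - a) * |t|) = a * |t| + -(Real.pi * |t|) by ring, Real.exp_add]; ring

lemma cosh_integrable (f : ℝ → ℂ) (hf : Continuous f) (C a : ℝ) (ha : a < Real.pi)
    (hb : ∀ t, ‖f t‖ ≤ C * Real.exp (a * |t|)) :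
    MeasureTheory.Integrable (fun t : ℝ => f t / (Real.cosh (Real.pi * t) : ℝ)) := by
  refine ((integrable_exp_abs (Real.pi - a) (by linarith)).const_mul (2 * C)).mono' ?_
    (Filter.Eventually.of_forall (cosh_bound f C a hb))
  have : Continuous (fun t : ℝ => f t / ((Real.cosh (Real.pi * t) : ℝ) : ℂ)) := by
    refine hf.div ?_ ?_
    · exact continuous_ofReal.comp (Real.continuous_cosh.comp (by fun_prop))
    · intro t
      exact_mod_cast (Real.cosh_pos _).ne'
  exact this.aestronglyMeasurable

lemma two_lines (g : ℂ → ℂ) (hg : Differentiable ℂ g) (C a : ℝ) (ha0 : 0 ≤ a) (ha : a < Real.pi)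
    (hb : ∀ s : ℂ, |s.re| ≤ 1/2 → ‖g s‖ ≤ C * Real.exp (a * |s.im|)) :
    (∫ t : ℝ, g (1/2 + t * I) / (Real.cosh (Real.pi * t) : ℝ))
      + (∫ t : ℝ, g (-1/2 + t * I) / (Real.cosh (Real.pi * t) : ℝ))
    = 2 * g 0 * ∫ t : ℝ, 1 / ((Real.cosh (Real.pi * t) : ℝ) : ℂ) := by
  have hg0 : ‖g 0‖ ≤ C := by simpa using hb 0 (by norm_num)
  have hC0 : 0 ≤ C := (norm_nonneg _).trans hg0
  have hc : ∀ t : ℝ, ((Real.cosh (Real.pi * t) : ℝ) : ℂ) ≠ 0 := fun t => by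
    exact_mod_cast (Real.cosh_pos _).ne'
  have i1 := cosh_integrable (fun t : ℝ => g (1/2 + t * I)) (hg.continuous.comp (by fun_prop)) C a ha
    (fun t => by simpa using hb (1/2 + t * I) (by norm_num))
  have i2 := cosh_integrable (fun t : ℝ => g (-1/2 + t * I)) (hg.continuous.comp (by fun_prop)) C a ha
    (fun t => by simpa using hb (-1/2 + t * I) (by norm_num [abs_div]))
  have i3 := (cosh_integrable (fun _ => 1) continuous_const 1 0 Real.pi_pos (by simp)).const_mul (g 0)
  set S : ℂ → ℂ := fun s => Complex.sin (Real.pi * s) with hS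
  have hSd : Differentiable ℂ S := by
    rw [hS]; fun_prop
  set H : ℂ → ℂ := fun s => dslope g 0 s / dslope S 0 s with hH
  have hHs : ∀ s : ℂ, s ≠ 0 → H s = (g s - g 0) / Complex.sin (Real.pi * s) := by
    intro s hs
    simp only [hH]
    rw [dslope_of_ne _ hs, dslope_of_ne _ hs, slope_def_field, slope_def_field]
    simp only [hS, mul_zero, Complex.sin_zero, sub_zero]
    rw [div_div_div_cancel_right₀ hs]
  have hH1 : ∀ t : ℝ, H (1/2 + t * I) = g (1/2 + t * I) / (Real.cosh (Real.pi * t) : ℝ)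
      - g 0 * (1 / (Real.cosh (Real.pi * t) : ℝ)) := by
    intro t
    rw [hHs _ (fun h => by have := congrArg re h; norm_num at this), sin_half]
    ring
  have hH2 : ∀ t : ℝ, H (-1/2 + t * I) = g 0 * (1 / (Real.cosh (Real.pi * t) : ℝ))
      - g (-1/2 + t * I) / (Real.cosh (Real.pi * t) : ℝ) := by
    intro t
    rw [hHs _ (fun h => by have := congrArg re h; norm_num at this), sin_neg_half]
    have := hc t
    field_simp
    ring
  have key := line_shift H (8 * C) (Real.pi - a) (by linarith) ?_ ?_ ?_ ?_
  · simp_rw [hH1, hH2] at key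
    rw [MeasureTheory.integral_sub i1 i3, MeasureTheory.integral_sub i3 i2,
      MeasureTheory.integral_const_mul] at key
    linear_combination key
  · have d1 : DifferentiableOn ℂ (dslope g 0) Set.univ :=
      (differentiableOn_dslope Filter.univ_mem).2 hg.differentiableOn
    have d2 : DifferentiableOn ℂ (dslope S 0) Set.univ :=
      (differentiableOn_dslope Filter.univ_mem).2 hSd.differentiableOn
    refine (d1.mono (Set.subset_univ _)).div (d2.mono (Set.subset_univ _)) ?_
    intro s hs
    by_cases h0 : s = 0
    · subst h0
      rw [dslope_same]
      have : HasDerivAt S (Complex.cos (Real.pi * 0) * (Real.pi * 1)) 0 :=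
        ((hasDerivAt_id (0:ℂ)).const_mul (Real.pi : ℂ)).csin
      rw [this.deriv]
      simp [Real.pi_ne_zero]
    · rw [dslope_of_ne _ h0, slope_def_field]
      simp only [hS, mul_zero, Complex.sin_zero, sub_zero]
      refine div_ne_zero ?_ h0
      intro h
      obtain ⟨k, hk⟩ := Complex.sin_eq_zero_iff.1 h
      have hpi : (Real.pi : ℂ) ≠ 0 := by exact_mod_cast Real.pi_ne_zero
      have hsk : s = k := by
        rw [mul_comm] at hk
        exact mul_right_cancel₀ hpi hk
      rw [hsk] at hs h0
      have hs' : |(k:ℝ)| ≤ 1/2 := by simpa using hs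
      have : |k| < 1 := by
        have : ((|k| : ℤ) : ℝ) < 1 := by push_cast; linarith
        exact_mod_cast this
      exact h0 (by simp [Int.abs_lt_one_iff.1 this])
  · intro s hs hs1
    rw [hHs s (fun h => by rw [h] at hs1; norm_num at hs1), norm_div]
    have h1 := norm_sin_ge s hs1
    have h2 : ‖g s - g 0‖ ≤ 2 * C * Real.exp (a * |s.im|) := by
      refine (norm_sub_le _ _).trans ?_
      have := hb s hs
      have h3 : 1 ≤ Real.exp (a * |s.im|) := Real.one_le_exp (by positivity)
      nlinarith
    calc _ ≤ (2 * C * Real.exp (a * |s.im|)) / (Real.exp (Real.pi * |s.im|) / 4) := by gcongr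
      _ = _ := by
        rw [show -((Real.pi - a) * |s.im|) = a * |s.im| - Real.pi * |s.im| by ring, Real.exp_sub]
        field_simp; ring
  · simp_rw [hH1]; exact i1.sub i3
  · simp_rw [hH2]; exact i3.sub i2

noncomputable def mlG (α β : ℝ) (w s : ℂ) : ℂ := (Gamma (α * s + β))⁻¹ * w ^ s

noncomputable def mlA (α β : ℝ) (w : ℂ) (c : ℂ) : ℂ :=
  ∫ t : ℝ, mlG α β w (c + t * I) / (Real.cosh (Real.pi * t) : ℝ)

noncomputable def mlK : ℂ := ∫ t : ℝ, 1 / ((Real.cosh (Real.pi * t) : ℝ) : ℂ)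

lemma mlK_ne : mlK ≠ 0 := by
  have h : mlK = ((∫ t : ℝ, 1 / Real.cosh (Real.pi * t) : ℝ) : ℂ) := by
    rw [mlK, ← integral_complex_ofReal]
    simp
  have hi : MeasureTheory.Integrable (fun t : ℝ => 1 / Real.cosh (Real.pi * t)) := by
    have := (cosh_integrable (fun _ => 1) continuous_const 1 0 Real.pi_pos (by simp)).re
    refine this.congr (Filter.Eventually.of_forall fun t => ?_)
    have : (1:ℂ) / ((Real.cosh (Real.pi * t) : ℝ) : ℂ) = ((1 / Real.cosh (Real.pi * t) : ℝ) : ℂ) := by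
      push_cast; rfl
    simp only [this]
    exact Complex.ofReal_re _
  rw [h]
  have hp : 0 < ∫ t : ℝ, 1 / Real.cosh (Real.pi * t) := by
    rw [MeasureTheory.integral_pos_iff_support_of_nonneg _ hi]
    · have : Function.support (fun t : ℝ => 1 / Real.cosh (Real.pi * t)) = Set.univ := by
        ext t
        simp [(Real.cosh_pos _).ne']
      rw [this]; simp
    · intro t
      have := Real.cosh_pos (Real.pi * t)
      positivity
  exact_mod_cast hp.ne'

lemma mlG_diff (α β : ℝ) (w : ℂ) (hw : w ≠ 0) : Differentiable ℂ (mlG α β w) := by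
  have h1 : Differentiable ℂ (fun s : ℂ => (Gamma (α * s + β))⁻¹) :=
    differentiable_one_div_Gamma.comp (g := fun s => (Gamma s)⁻¹) (f := fun s : ℂ => α * s + β) (by fun_prop)
  have h2 : Differentiable ℂ (fun s : ℂ => w ^ s) := fun s =>
    differentiableAt_id.const_cpow (Or.inl hw)
  exact h1.mul h2

lemma norm_cpow_le' (w s : ℂ) (hw : w ≠ 0) (θ : ℝ) (hθ : |w.arg| ≤ θ) :
    ‖w ^ s‖ ≤ ‖w‖ ^ s.re * Real.exp (θ * |s.im|) := by
  rw [norm_cpow_of_ne_zero hw, div_eq_mul_inv, ← Real.exp_neg]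
  gcongr
  calc -(w.arg * s.im) ≤ |w.arg * s.im| := neg_le_abs _
    _ = |w.arg| * |s.im| := abs_mul _ _
    _ ≤ _ := by gcongr

lemma mlG_bound (α β : ℝ) (hα : 0 < α) (ε θ R : ℝ) (hε : 0 < ε) :
    ∃ C : ℝ, 0 < C ∧ ∀ w : ℂ, w ≠ 0 → |w.arg| ≤ θ → ∀ s : ℂ, |s.re| ≤ R →
      ‖mlG α β w s‖ ≤ C * ‖w‖ ^ s.re * Real.exp ((α * (Real.pi / 2 + ε) + θ) * |s.im|) := by
  obtain ⟨m, hm⟩ := exists_nat_ge (1 + α * R - β)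
  obtain ⟨C, hC0, hC⟩ := inv_Gamma_strip ε hε (α * R + β) m
  refine ⟨C, hC0, fun w hw hθ s hs => ?_⟩
  have hs' := abs_le.1 hs
  have h1 := hC (α * s.re + β) (α * s.im) (by nlinarith) (by nlinarith)
  have e : (((α * s.re + β : ℝ) : ℂ) + ((α * s.im : ℝ) : ℂ) * I) = α * s + β := by
    apply Complex.ext <;> simp
  rw [e, abs_mul, abs_of_pos hα] at h1
  have h2 := norm_cpow_le' w s hw θ hθ
  rw [mlG, norm_mul]
  calc _ ≤ (C * Real.exp ((Real.pi / 2 + ε) * (α * |s.im|))) * (‖w‖ ^ s.re * Real.exp (θ * |s.im|)) := by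
        gcongr
    _ = _ := by
      rw [show (α * (Real.pi / 2 + ε) + θ) * |s.im| = (Real.pi / 2 + ε) * (α * |s.im|) + θ * |s.im| by ring,
        Real.exp_add]
      ring

lemma rpow_le_sum (r x R : ℝ) (hr : 0 < r) (hx : |x| ≤ R) : r ^ x ≤ r ^ R + r ^ (-R) := by
  have h := abs_le.1 hx
  have p1 := Real.rpow_pos_of_pos hr R
  have p2 := Real.rpow_pos_of_pos hr (-R)
  rcases le_total 1 r with h1 | h1
  · have := Real.rpow_le_rpow_of_exponent_le h1 h.2
    linarith
  · have := Real.rpow_le_rpow_of_exponent_ge hr h1 h.1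
    linarith

lemma mlA_step (α β : ℝ) (hα : 0 < α) (ε θ : ℝ) (hε : 0 < ε) (hθ0 : 0 ≤ θ)
    (ha : α * (Real.pi / 2 + ε) + θ < Real.pi) (w : ℂ) (hw : w ≠ 0) (hθ : |w.arg| ≤ θ) (n : ℝ) :
    mlA α β w (n + 1/2) + mlA α β w (n - 1/2) = 2 * mlG α β w n * mlK := by
  obtain ⟨C, hC0, hC⟩ := mlG_bound α β hα ε θ (|n| + 1/2) hε
  have hwn : 0 < ‖w‖ := norm_pos_iff.2 hw
  have := two_lines (fun s => mlG α β w (n + s)) ((mlG_diff α β w hw).comp (by fun_prop))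
    (C * (‖w‖ ^ (|n| + 1/2) + ‖w‖ ^ (-(|n| + 1/2)))) (α * (Real.pi / 2 + ε) + θ)
    (by have := Real.pi_pos; positivity) ha (by
      intro s hs
      have hs2 : |((n:ℂ) + s).re| ≤ |n| + 1/2 := by
        simp only [add_re, ofReal_re]
        exact (abs_add_le _ _).trans (by linarith)
      have h := hC w hw hθ (n + s) hs2
      have h2 := rpow_le_sum ‖w‖ _ _ hwn hs2
      have h3 : ((n:ℂ) + s).im = s.im := by simp
      rw [h3] at h
      refine h.trans ?_
      gcongr)
  rw [mlK, mlA, mlA]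
  simp only [add_zero] at this
  rw [← this]
  congr 2
  · ext t; rw [add_assoc]
  · ext t; rw [show (n:ℂ) - 1/2 + t * I = n + (-1/2 + t * I) by ring]

lemma mlA_norm (α β : ℝ) (a : ℝ) (ha : a < Real.pi) (w : ℂ) (c C : ℝ)
    (h : ∀ t : ℝ, ‖mlG α β w (c + t * I)‖ ≤ C * Real.exp (a * |t|)) :
    ‖mlA α β w c‖ ≤ C * (2 * ∫ t : ℝ, Real.exp (-((Real.pi - a) * |t|))) := by
  have := MeasureTheory.norm_integral_le_of_norm_le
    ((integrable_exp_abs (Real.pi - a) (by linarith)).const_mul (2 * C))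
    (Filter.Eventually.of_forall (cosh_bound _ C a h))
  rw [MeasureTheory.integral_const_mul] at this
  rw [mlA]
  refine this.trans (le_of_eq (by ring))

lemma factorial_le_Gamma (n : ℕ) (x : ℝ) (hx : n + 2 ≤ x) : (n.factorial : ℝ) ≤ Real.Gamma x := by
  have h1 := Real.Gamma_nat_eq_factorial (n+1)
  have h2 : Real.Gamma (n + 2) ≤ Real.Gamma x :=
    Real.Gamma_strictMonoOn_Ici.monotoneOn (by simp) (by
      have := (n.cast_nonneg : (0:ℝ) ≤ n)
      simp only [Set.mem_Ici]; linarith) hx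
  push_cast at h1
  rw [show (n:ℝ) + 2 = n + 1 + 1 by ring, h1] at h2
  have h3 : (n.factorial : ℝ) ≤ ((n+1).factorial : ℝ) := by
    exact_mod_cast Nat.factorial_le (Nat.le_succ n)
  linarith

lemma ml_summable (α β : ℝ) (hα : 1 < α) (hβ : 0 < β) (r : ℝ) (hr : 0 ≤ r) :
    Summable (fun k : ℕ => r ^ k / Real.Gamma (α * k + β)) := by
  rw [← summable_nat_add_iff 2]
  refine Summable.of_nonneg_of_le (fun k => ?_) (fun k => ?_)
    ((Real.summable_pow_div_factorial r).mul_left (r^2))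
  · have : 0 < Real.Gamma (α * ((k + 2 : ℕ):ℝ) + β) := Real.Gamma_pos_of_pos (by positivity)
    positivity
  · have h := factorial_le_Gamma k (α * ((k + 2 : ℕ):ℝ) + β) (by
      push_cast
      have := (k.cast_nonneg : (0:ℝ) ≤ k)
      nlinarith)
    rw [mul_div_assoc', ← pow_add, add_comm 2 k]
    gcongr

lemma mlA_tendsto (α β : ℝ) (hα : 1 < α) (hβ : 0 < β) (θ : ℝ)
    (ha : α * (Real.pi / 2) + θ < Real.pi) (w : ℂ) (hw : w ≠ 0) (hθ : |w.arg| ≤ θ) :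
    Filter.Tendsto (fun n : ℕ => mlA α β w (((n:ℝ) - 1/2 : ℝ) : ℂ)) Filter.atTop (nhds 0) := by
  rw [← Filter.tendsto_add_atTop_iff_nat 3]
  have hwn : 0 < ‖w‖ := norm_pos_iff.2 hw
  have hz := ((FloorSemiring.tendsto_pow_div_factorial_atTop ‖w‖).const_mul (‖w‖ ^ (5/2:ℝ))).mul_const
    (2 * ∫ t : ℝ, Real.exp (-((Real.pi - (α * (Real.pi / 2) + θ)) * |t|)))
  rw [mul_zero, zero_mul] at hz
  refine squeeze_zero_norm (fun n => ?_) hz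
  refine mlA_norm α β _ ha w _ _ (fun t => ?_)
  set c : ℝ := ((n + 3 : ℕ) : ℝ) - 1/2 with hc
  have hn := (n.cast_nonneg : (0:ℝ) ≤ n)
  have hc' : c = n + 5/2 := by rw [hc]; push_cast; ring
  have hx : (n:ℝ) + 2 ≤ α * c + β := by rw [hc']; nlinarith
  have h1 := inv_Gamma_le (α * c + β) (α * t) (by linarith)
  have e : (((α * c + β : ℝ) : ℂ) + ((α * t : ℝ) : ℂ) * I) = α * (c + t * I) + β := by
    push_cast; ring
  rw [e, abs_mul, abs_of_pos (by linarith : 0 < α)] at h1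
  have h2 := norm_cpow_le' w (c + t * I) hw θ hθ
  have e1 : ((c:ℂ) + t * I).re = c := by simp
  have e2 : ((c:ℂ) + t * I).im = t := by simp
  rw [e1, e2] at h2
  have h3 := factorial_le_Gamma n _ hx
  have hf : (0:ℝ) < n.factorial := by exact_mod_cast n.factorial_pos
  rw [mlG, norm_mul]
  calc _ ≤ (Real.exp (Real.pi / 2 * (α * |t|)) / n.factorial) * (‖w‖ ^ c * Real.exp (θ * |t|)) := by
        gcongr
        exact h1.trans (by gcongr)
    _ = _ := by
      rw [show (α * (Real.pi / 2) + θ) * |t| = Real.pi / 2 * (α * |t|) + θ * |t| by ring,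
        Real.exp_add, hc', Real.rpow_add hwn, Real.rpow_natCast]
      ring

lemma arg_neg_le (μ : ℝ) (hμ : 0 < μ) (z : ℂ) (h : μ ≤ |z.arg|) (h2 : |z.arg| ≤ Real.pi) :
    |(-z).arg| ≤ Real.pi - μ := by
  rcases lt_trichotomy z.im 0 with hi | hi | hi
  · rw [arg_neg_eq_arg_add_pi_of_im_neg hi]
    have := arg_neg_iff.2 hi
    rw [abs_of_neg this] at h h2
    rw [abs_le]; constructor <;> linarith
  · rcases le_or_gt 0 z.re with hr | hr
    · have : z.arg = 0 := arg_eq_zero_iff.2 ⟨hr, hi⟩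
      rw [this, abs_zero] at h
      linarith
    · have : (-z).arg = 0 := arg_eq_zero_iff.2 ⟨by simp; linarith, by simp [hi]⟩
      rw [this, abs_zero]
      linarith
  · rw [arg_neg_eq_arg_sub_pi_of_im_pos hi]
    have := arg_nonneg_iff.2 hi.le
    rw [abs_of_nonneg this] at h h2
    rw [abs_le]; constructor <;> linarith

/-- Let `α ∈ (1,2)` and `β > 0`. For every `μ` with `πα/2 < μ < π` there is a constant
`C = C(α,β,μ) > 0` such that `|E_{α,β}(z)| ≤ C/(1+|z|)` whenever `μ ≤ |arg z| ≤ π`. -/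
theorem mittagLeffler_bound (α β : ℝ) (hα1 : 1 < α) (hα2 : α < 2) (hβ : 0 < β)
    (μ : ℝ) (hμ1 : Real.pi * α / 2 < μ) (hμ2 : μ < Real.pi) :
    ∃ C : ℝ, 0 < C ∧ ∀ z : ℂ, μ ≤ |z.arg| → |z.arg| ≤ Real.pi →
      ‖mittagLefflerC α β z‖ ≤ C / (1 + ‖z‖) := by
  have hα0 : 0 < α := by linarith
  have hpi := Real.pi_pos
  have hμ0 : 0 < μ := by
    have : 0 < Real.pi * α / 2 := by positivity
    linarith
  set ε : ℝ := (μ - Real.pi * α / 2) / (2 * α) with hεd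
  have hε : 0 < ε := div_pos (by linarith) (by linarith)
  have hαε : α * ε = (μ - Real.pi * α / 2) / 2 := by rw [hεd]; field_simp
  set θ : ℝ := Real.pi - μ with hθd
  have hθ0 : 0 ≤ θ := by linarith
  have ha : α * (Real.pi / 2 + ε) + θ < Real.pi := by rw [mul_add, hαε]; linarith
  have ha' : α * (Real.pi / 2) + θ < Real.pi := by linarith
  set a := α * (Real.pi / 2 + ε) + θ with had
  obtain ⟨C₁, hC₁, hb⟩ := mlG_bound α β hα0 ε θ 2 hε
  set J : ℝ := 2 * ∫ t : ℝ, Real.exp (-((Real.pi - a) * |t|)) with hJ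
  have hJ0 : 0 ≤ J := mul_nonneg zero_le_two
    (MeasureTheory.integral_nonneg fun t => (Real.exp_pos _).le)
  have hK : 0 < ‖mlK‖ := norm_pos_iff.2 mlK_ne
  set B : ℝ := ∑' k : ℕ, (1:ℝ) ^ k / Real.Gamma (α * k + β) with hB
  have hGpos : ∀ k : ℕ, 0 < Real.Gamma (α * k + β) := fun k => Real.Gamma_pos_of_pos (by positivity)
  have hB0 : 0 ≤ B := tsum_nonneg fun k => by have := hGpos k; positivity
  set D : ℝ := C₁ + C₁ * J / (2 * ‖mlK‖) with hD
  have hD0 : 0 < D := by positivity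
  have hnorm : ∀ (z : ℂ) (k : ℕ), ‖z ^ k / Complex.Gamma ((α * (k : ℝ) + β : ℝ) : ℂ)‖
      = ‖z‖ ^ k / Real.Gamma (α * k + β) := fun z k => by
    rw [norm_div, norm_pow, Complex.Gamma_ofReal, norm_real, Real.norm_of_nonneg (hGpos k).le]
  refine ⟨2 * (B + D), by positivity, fun z hz1 hz2 => ?_⟩
  have hsum : Summable (fun k : ℕ => z ^ k / Complex.Gamma ((α * (k : ℝ) + β : ℝ) : ℂ)) := by
    apply Summable.of_norm
    simp_rw [hnorm]
    exact ml_summable α β hα1 hβ _ (norm_nonneg _)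
  rw [le_div_iff₀ (by positivity)]
  rcases le_or_gt ‖z‖ 1 with hz | hz
  · have h1 : ‖mittagLefflerC α β z‖ ≤ B := by
      rw [mittagLefflerC]
      refine (norm_tsum_le_tsum_norm hsum.norm).trans ?_
      refine hsum.norm.tsum_le_tsum (fun k => ?_) (ml_summable α β hα1 hβ 1 zero_le_one)
      rw [hnorm]
      have := hGpos k
      gcongr
    calc _ ≤ B * 2 := by gcongr; linarith
      _ ≤ _ := by linarith
  · have hz0 : z ≠ 0 := by rintro rfl; simp at hz; linarith
    set w := -z with hw
    have hwz : ‖w‖ = ‖z‖ := norm_neg z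
    have hw0 : w ≠ 0 := neg_ne_zero.2 hz0
    have harg : |w.arg| ≤ θ := arg_neg_le μ hμ0 z hz1 hz2
    have hstep := mlA_step α β hα0 ε θ hε hθ0 ha w hw0 harg
    have hpart : ∀ n : ℕ, 2 * mlK * ∑ k ∈ Finset.range n,
        z ^ k / Complex.Gamma ((α * (k : ℝ) + β : ℝ) : ℂ)
        = mlA α β w (-1/2) - (-1) ^ n * mlA α β w (((n:ℝ) - 1/2 : ℝ) : ℂ) := by
      intro n
      induction n with
      | zero => simp; norm_num
      | succ n ih =>
        rw [Finset.sum_range_succ, mul_add, ih]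
        have h := hstep n
        have e1 : ((((n + 1 : ℕ):ℝ) - 1/2 : ℝ) : ℂ) = ((n:ℝ):ℂ) + 1/2 := by push_cast; ring
        have e2 : (((n:ℝ) - 1/2 : ℝ) : ℂ) = ((n:ℝ):ℂ) - 1/2 := by push_cast; ring
        rw [e1, e2]
        have e3 : z ^ n / Complex.Gamma ((α * (n : ℝ) + β : ℝ) : ℂ) = (-1)^n * mlG α β w (n:ℝ) := by
          rw [mlG]
          push_cast
          rw [cpow_natCast, hw, neg_pow z n]
          have : ((-1:ℂ)^n) * (-1)^n = 1 := by rw [← mul_pow]; norm_num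
          linear_combination (-(z ^ n / Complex.Gamma (α * n + β))) * this
        rw [e3, pow_succ]
        linear_combination (-(-1)^n) * h
    have hlim : 2 * mlK * mittagLefflerC α β z = mlA α β w (-1/2) := by
      have t1 := (hsum.hasSum.tendsto_sum_nat).const_mul (2 * mlK)
      have t2 : Filter.Tendsto (fun n : ℕ => (-1:ℂ) ^ n * mlA α β w (((n:ℝ) - 1/2 : ℝ) : ℂ))
          Filter.atTop (nhds 0) := by
        have := (mlA_tendsto α β hα1 hβ θ ha' w hw0 harg).norm
        rw [norm_zero] at this
        refine squeeze_zero_norm (fun n => ?_) this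
        simp
      have t3 := t2.const_sub (mlA α β w (-1/2))
      rw [sub_zero] at t3
      simp_rw [hpart] at t1
      exact tendsto_nhds_unique t1 t3
    have h1 := hstep (-1)
    rw [show (((-1:ℝ):ℂ) + 1/2) = -1/2 by push_cast; ring, ← hlim,
      show (((-1:ℝ):ℂ) - 1/2) = ((-3/2:ℝ):ℂ) by push_cast; ring] at h1
    have hE : mittagLefflerC α β z = mlG α β w ((-1:ℝ):ℂ)
        - mlA α β w ((-3/2:ℝ):ℂ) / (2 * mlK) := by
      have := mlK_ne
      generalize mlA α β w ((-3/2:ℝ):ℂ) = u at h1 ⊢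
      field_simp
      linear_combination h1
    have hwpos : 0 < ‖w‖ := norm_pos_iff.2 hw0
    have b1 : ‖mlG α β w ((-1:ℝ):ℂ)‖ ≤ C₁ * ‖z‖⁻¹ := by
      have := hb w hw0 harg ((-1:ℝ):ℂ) (by rw [ofReal_re]; norm_num)
      rw [ofReal_re, ofReal_im, Real.rpow_neg_one, abs_zero, mul_zero, Real.exp_zero, mul_one, hwz] at this
      exact this
    have b2 : ‖mlA α β w ((-3/2:ℝ):ℂ)‖ ≤ C₁ * ‖z‖⁻¹ * J := by
      refine mlA_norm α β a ha w _ _ (fun t => ?_)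
      have := hb w hw0 harg (((-3/2:ℝ):ℂ) + t * I) (by simp [abs_div]; norm_num)
      have e1 : (((-3/2:ℝ):ℂ) + t * I).re = -3/2 := by simp
      have e2 : (((-3/2:ℝ):ℂ) + t * I).im = t := by simp
      rw [e1, e2] at this
      refine this.trans ?_
      have : ‖w‖ ^ (-3/2:ℝ) ≤ ‖z‖⁻¹ := by
        rw [hwz, ← Real.rpow_neg_one]
        exact Real.rpow_le_rpow_of_exponent_le hz.le (by norm_num)
      gcongr
    have b3 : ‖mittagLefflerC α β z‖ ≤ D * ‖z‖⁻¹ := by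
      rw [hE]
      refine (norm_sub_le _ _).trans ?_
      rw [norm_div, norm_mul, show ‖(2:ℂ)‖ = 2 by simp]
      calc _ ≤ C₁ * ‖z‖⁻¹ + C₁ * ‖z‖⁻¹ * J / (2 * ‖mlK‖) := by gcongr
        _ = _ := by rw [hD]; ring
    have hzp : 0 < ‖z‖ := by linarith
    calc _ ≤ (D * ‖z‖⁻¹) * (2 * ‖z‖) := by gcongr; linarith
      _ = 2 * D := by field_simp
      _ ≤ _ := by linarith
end

section
/- Let α ∈ (1,2), T > 0, u₀ ∈ D(√A) and u₁ ∈ H. Then the series u(t) = Σ_{n=1}^∞ [ ⟨u₀,e_n⟩ E_{α,1}(−λ_n t^α) + ⟨u₁,e_n⟩ t E_{α,2}(−λ_n t^α) ] e_n converges in D(√A) uniformly in t ∈ [0,T], so u ∈ C([0,T]; D(√A)) with u(0) = u₀; moreover there is a constant C > 0 depending only on α such that ‖√A u(t)‖² ≤ C ‖√A u₀‖² + C T^{2−α} ‖u₁‖² for all t ∈ [0,T]. -/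
open scoped RealInnerProductSpace

/-- The Mittag-Leffler function `E_{α,β}(x) = ∑_{k=0}^∞ x^k / Γ(αk + β)` (real argument). -/
noncomputable def ML (α β x : ℝ) : ℝ :=
  ∑' k : ℕ, x ^ k / Real.Gamma (α * (k : ℝ) + β)

/-- Coefficients of `(1-x)^{-s}`. -/
noncomputable def gc (s : ℝ) : ℕ → ℝ
  | 0 => 1
  | n + 1 => gc s n * ((s + n) / (n + 1))

lemma gc_eq_multichoose (s : ℝ) (n : ℕ) : gc s n = Ring.multichoose s n := by
  have h : ∀ n : ℕ, (n.factorial : ℝ) * gc s n = (ascPochhammer ℝ n).eval s := by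
    intro n
    induction n with
    | zero => simp [gc]
    | succ n ih =>
      rw [ascPochhammer_succ_eval, ← ih, gc, Nat.factorial_succ]
      push_cast
      have : (n : ℝ) + 1 ≠ 0 := by positivity
      field_simp
  have h2 := Ring.factorial_nsmul_multichoose_eq_ascPochhammer s n
  rw [nsmul_eq_mul, Polynomial.ascPochhammer_smeval_eq_eval, ← h] at h2
  have : (n.factorial : ℝ) ≠ 0 := by positivity
  exact (mul_left_cancel₀ this h2).symm

lemma gc_eq_choose (s : ℝ) (n : ℕ) : gc s n = Ring.choose (s + n - 1) n := by
  rw [gc_eq_multichoose, Ring.multichoose_eq]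

lemma gc_eq_neg (s : ℝ) (n : ℕ) : gc s n = (-1) ^ n * Ring.choose (-s) n := by
  rw [gc_eq_choose, Ring.choose_neg]
  simp [Units.smul_def, ← mul_assoc, ← mul_pow]

lemma gc_vand (s r : ℝ) (n : ℕ) :
    ∑ p ∈ Finset.HasAntidiagonal.antidiagonal n, gc s p.1 * gc r p.2 = gc (s + r) n := by
  rw [gc_eq_neg, neg_add, Ring.add_choose_eq n (Commute.all _ _), Finset.mul_sum]
  refine Finset.sum_congr rfl fun p hp => ?_
  rw [Finset.HasAntidiagonal.mem_antidiagonal] at hp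
  rw [gc_eq_neg, gc_eq_neg, ← hp, pow_add]
  ring

lemma gc_nonneg {s : ℝ} (hs : 0 ≤ s) (n : ℕ) : 0 ≤ gc s n := by
  induction n with
  | zero => simp [gc]
  | succ n ih => rw [gc]; positivity

lemma gc_neg_nonpos {b : ℝ} (h0 : 0 ≤ b) (h1 : b ≤ 1) (n : ℕ) : gc (-b) (n + 1) ≤ 0 := by
  induction n with
  | zero => simp [gc, h0]
  | succ n ih =>
    rw [gc]
    apply mul_nonpos_of_nonpos_of_nonneg ih
    push_cast
    have : 0 ≤ -b + ((n : ℝ) + 1) := by have : (0 : ℝ) ≤ n := by positivity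
                                        linarith
    positivity

lemma gc_one (n : ℕ) : gc 1 n = 1 := by
  induction n with
  | zero => simp [gc]
  | succ n ih =>
    rw [gc, ih, one_mul, add_comm]
    exact div_self (by positivity)

lemma gc_bound {s y : ℝ} (hs : 1 ≤ s) (hy0 : 0 < y) (hy1 : y < 1) (n : ℕ) :
    gc s n * y ^ n ≤ (1 - y) ^ (1 - s) := by
  have hS : HasSum (fun m => gc (s - 1) m * y ^ m) ((1 - y) ^ (1 - s)) := by
    have h := (Real.one_div_one_sub_rpow_hasFPowerSeriesOnBall_zero (s - 1)).hasSum (y := y)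
      (by simp [abs_of_pos hy0, hy1, ← ENNReal.ofReal_one, Metric.eball_ofReal])
    have e : (1 - y) ^ (1 - s) = 1 / (1 - (0 + y)) ^ (s - 1) := by
      rw [zero_add, one_div, ← Real.rpow_neg (by linarith), neg_sub]
    have e' : (fun m => gc (s - 1) m * y ^ m) = fun n =>
        (FormalMultilinearSeries.ofScalars ℝ
          (fun n => Ring.choose (s - 1 + (n : ℝ) - 1) n) n) fun _ : Fin n => y := by
      ext m
      simp [gc_eq_choose, FormalMultilinearSeries.ofScalars]
    rw [e, e']
    exact h
  have hg : gc s n = ∑ m ∈ Finset.range (n + 1), gc (s - 1) m := by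
    have h := gc_vand (s - 1) 1 n
    rw [sub_add_cancel] at h
    rw [← h, Finset.Nat.sum_antidiagonal_eq_sum_range_succ_mk]
    simp [gc_one]
  have hn : ∀ m, 0 ≤ gc (s - 1) m := fun m => gc_nonneg (by linarith) m
  calc gc s n * y ^ n = ∑ m ∈ Finset.range (n + 1), gc (s - 1) m * y ^ n := by
        rw [hg, Finset.sum_mul]
    _ ≤ ∑ m ∈ Finset.range (n + 1), gc (s - 1) m * y ^ m := by
        refine Finset.sum_le_sum fun m hm => mul_le_mul_of_nonneg_left ?_ (hn m)
        exact pow_le_pow_of_le_one hy0.le hy1.le (by simpa [Nat.lt_succ_iff] using hm)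
    _ ≤ _ := sum_le_hasSum _ (fun m _ => mul_nonneg (hn m) (by positivity)) hS

lemma gc_prod (s : ℝ) (n : ℕ) : gc s n = (∏ j ∈ Finset.range n, (s + j)) / n.factorial := by
  induction n with
  | zero => simp [gc]
  | succ n ih =>
    rw [gc, ih, Finset.prod_range_succ, Nat.factorial_succ]
    push_cast
    have : (n.factorial : ℝ) ≠ 0 := by positivity
    field_simp

lemma gc_tendsto {s : ℝ} (hs : 0 < s) :
    Filter.Tendsto (fun n : ℕ => gc s n * (n : ℝ) ^ (1 - s)) Filter.atTop
      (nhds (1 / Real.Gamma s)) := by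
  have h1 := (Real.GammaSeq_tendsto_Gamma s).inv₀ (Real.Gamma_pos_of_pos hs).ne'
  have h2 : Filter.Tendsto (fun n : ℕ => (n : ℝ) / (n + s)) Filter.atTop (nhds 1) :=
    tendsto_natCast_div_add_atTop s
  have h3 := h2.mul h1
  rw [one_mul, ← one_div] at h3
  refine h3.congr' ?_
  filter_upwards [Filter.eventually_gt_atTop 0] with n hn
  have hn' : (0 : ℝ) < n := by exact_mod_cast hn
  rw [Real.GammaSeq, gc_prod, Finset.prod_range_succ, Real.rpow_sub hn', Real.rpow_one]
  have : ∏ j ∈ Finset.range n, (s + j) ≠ 0 := Finset.prod_ne_zero_iff.2 fun j _ => by positivity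
  have : (n.factorial : ℝ) ≠ 0 := by positivity
  have : (n : ℝ) ^ s ≠ 0 := by positivity
  field_simp
  ring_nf

lemma z_bound {b g : ℝ} (h0 : 0 < b) (h1 : b < 1) (hg : b ≤ g) {μ : ℂ} (hμ : μ.re = 0)
    {N : ℕ} (hs : ∀ n, n ≤ N → Summable fun k : ℕ => μ ^ k * (gc (b * k + g) n : ℂ))
    (n : ℕ) (hnN : n ≤ N) :
    ‖∑' k : ℕ, μ ^ k * (gc (b * k + g) n : ℂ)‖ ≤ gc g n := by
  set z : ℕ → ℂ := fun n => ∑' k : ℕ, μ ^ k * (gc (b * k + g) n : ℂ) with hz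
  have key : ∀ n, n ≤ N → ∑ p ∈ Finset.HasAntidiagonal.antidiagonal n, (gc (-b) p.1 : ℂ) * z p.2
      = gc (g - b) n + μ * z n := by
    intro n hnN
    have e1 : ∑ p ∈ Finset.HasAntidiagonal.antidiagonal n, (gc (-b) p.1 : ℂ) * z p.2
        = ∑' k : ℕ, μ ^ k * (gc (b * k + g - b) n : ℂ) := by
      simp only [hz, ← tsum_mul_left]
      rw [← Summable.tsum_finsetSum]
      · congr 1; ext k
        have := gc_vand (-b) (b * k + g) n
        rw [show b * k + g - b = -b + (b * k + g) by ring, ← this]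
        push_cast
        rw [Finset.mul_sum]
        exact Finset.sum_congr rfl fun p _ => by ring
      · intro p hp
        rw [Finset.HasAntidiagonal.mem_antidiagonal] at hp
        exact (hs p.2 (by omega)).mul_left _
    have e2 : (fun k : ℕ => μ ^ (k + 1) * (gc (b * (k + 1 : ℕ) + g - b) n : ℂ))
        = fun k : ℕ => μ * (μ ^ k * (gc (b * k + g) n : ℂ)) := by
      ext k
      rw [show b * ((k + 1 : ℕ) : ℝ) + g - b = b * k + g by push_cast; ring]
      ring
    have sm : Summable fun k : ℕ => μ ^ k * (gc (b * k + g - b) n : ℂ) := by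
      rw [← summable_nat_add_iff 1, e2]
      exact (hs n hnN).mul_left μ
    rw [e1, sm.tsum_eq_zero_add, e2, tsum_mul_left]
    simp only [pow_zero, Nat.cast_zero, mul_zero, zero_add, one_mul, hz]
  have hn1 : 1 ≤ ‖1 - μ‖ := by
    have := Complex.abs_re_le_norm (1 - μ)
    simpa [hμ] using this
  change ‖z n‖ ≤ _
  induction n using Nat.strong_induction_on with
  | _ n ih =>
  cases n with
  | zero =>
    have h := key 0 hnN
    simp [gc] at h
    have h' : (1 - μ) * z 0 = 1 := by linear_combination h
    have h'' := congrArg norm h'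
    rw [norm_mul, norm_one] at h''
    simp only [gc]
    nlinarith [norm_nonneg (z 0)]
  | succ n =>
    have h := key (n + 1) hnN
    have hb := gc_vand (-b) g (n + 1)
    rw [Finset.Nat.sum_antidiagonal_succ] at h hb
    simp only [gc, Complex.ofReal_one, one_mul] at h
    rw [show gc (-b) 0 = 1 from rfl, one_mul, show -b + g = g - b by ring] at hb
    have h' : (1 - μ) * z (n + 1) = gc (g - b) (n + 1)
        + ∑ p ∈ Finset.HasAntidiagonal.antidiagonal n, ((-gc (-b) (p.1 + 1) : ℝ) : ℂ) * z p.2 := by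
      simp only [Complex.ofReal_neg, neg_mul, Finset.sum_neg_distrib]
      simp only [gc] at h ⊢
      linear_combination h
    have h2 : ‖(1 - μ) * z (n + 1)‖ ≤ gc g (n + 1) := by
      rw [h']
      calc _ ≤ gc (g - b) (n + 1) + ∑ p ∈ Finset.HasAntidiagonal.antidiagonal n,
            (-gc (-b) (p.1 + 1)) * gc g p.2 := by
            refine (norm_add_le _ _).trans (add_le_add ?_ ?_)
            · rw [Complex.norm_real, Real.norm_of_nonneg (gc_nonneg (by linarith) _)]
            · refine (norm_sum_le _ _).trans (Finset.sum_le_sum fun p hp => ?_)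
              have hneg := gc_neg_nonpos h0.le h1.le p.1
              rw [norm_mul, Complex.norm_real, Real.norm_of_nonneg (by linarith)]
              refine mul_le_mul_of_nonneg_left (ih p.2 ?_ ?_) (by linarith)
              all_goals
                rw [Finset.HasAntidiagonal.mem_antidiagonal] at hp
                omega
        _ = gc g (n + 1) := by
            simp only [neg_mul, Finset.sum_neg_distrib]
            linarith
    rw [norm_mul] at h2
    nlinarith [norm_nonneg (z (n + 1))]

lemma gc_le {s c : ℝ} (hs : 1 ≤ s) (hc : 0 < c) {n m : ℕ} (hm : m ≤ n) (hn : c ≤ n) :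
    gc s m ≤ Real.exp c * (2 * n / c) ^ (s - 1) := by
  have hn0 : (0 : ℝ) < n := hc.trans_le hn
  set y : ℝ := n / (n + c) with hy
  have hy0 : 0 < y := by positivity
  have hy1 : y < 1 := by rw [hy, div_lt_one (by positivity)]; linarith
  have h := gc_bound hs hy0 hy1 m
  have e1 : (1 - y) ^ (1 - s) = ((n + c) / c) ^ (s - 1) := by
    rw [show 1 - y = ((n + c) / c)⁻¹ by rw [hy]; field_simp; ring,
      Real.inv_rpow (by positivity), ← Real.rpow_neg (by positivity), neg_sub]
  have e2 : ((n + c) / c) ^ (s - 1) ≤ (2 * n / c) ^ (s - 1) := by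
    apply Real.rpow_le_rpow (by positivity) _ (by linarith)
    gcongr
    linarith
  have e3 : 1 ≤ Real.exp c * y ^ m := by
    have h1 : y ^ n ≤ y ^ m := pow_le_pow_of_le_one hy0.le hy1.le hm
    have h2 : Real.exp (-(c / n)) ≤ y := by
      rw [Real.exp_neg, inv_le_comm₀ (Real.exp_pos _) hy0]
      calc y⁻¹ = c / n + 1 := by rw [hy]; field_simp; ring
        _ ≤ _ := Real.add_one_le_exp _
    have h3 : Real.exp (-c) ≤ y ^ n := by
      calc Real.exp (-c) = Real.exp (-(c / n)) ^ n := by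
            rw [← Real.exp_nat_mul]; congr 1; field_simp
        _ ≤ _ := by gcongr
    calc (1 : ℝ) = Real.exp c * Real.exp (-c) := by rw [← Real.exp_add]; simp
      _ ≤ _ := by gcongr; exact h3.trans h1
  have g0 := gc_nonneg (by linarith : 0 ≤ s) m
  calc gc s m ≤ gc s m * (Real.exp c * y ^ m) := le_mul_of_one_le_right g0 e3
    _ = Real.exp c * (gc s m * y ^ m) := by ring
    _ ≤ _ := by gcongr; linarith

lemma gc_scaled_le {s c : ℝ} (hs : 1 ≤ s) (hc : 0 < c) {n : ℕ} (hn : c ≤ n) :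
    gc s n * (n : ℝ) ^ (1 - s) ≤ Real.exp c * (2 / c) ^ (s - 1) := by
  have hn0 : (0 : ℝ) < n := hc.trans_le hn
  have h := gc_le hs hc le_rfl hn
  calc gc s n * (n : ℝ) ^ (1 - s)
      ≤ (Real.exp c * (2 * n / c) ^ (s - 1)) * (n : ℝ) ^ (1 - s) := by gcongr
    _ = _ := by
      rw [show 2 * (n : ℝ) / c = 2 / c * n by ring, Real.mul_rpow (by positivity) hn0.le,
        show 1 - s = -(s - 1) by ring, Real.rpow_neg hn0.le]
      have : (n : ℝ) ^ (s - 1) ≠ 0 := by positivity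
      field_simp

lemma inv_gamma_le {s c : ℝ} (hs : 1 ≤ s) (hc : 0 < c) :
    1 / Real.Gamma s ≤ Real.exp c * (2 / c) ^ (s - 1) := by
  refine le_of_tendsto (gc_tendsto (by linarith)) ?_
  filter_upwards [Filter.eventually_ge_atTop ⌈c⌉₊] with n hn
  exact gc_scaled_le hs hc (Nat.ceil_le.1 hn)

lemma exists_c {a R : ℝ} (ha : 0 < a) (hR : 0 ≤ R) : ∃ c : ℝ, 0 < c ∧ R * (2 / c) ^ a ≤ 1 / 2 := by
  refine ⟨2 * (2 * R + 1) ^ (1 / a), by positivity, ?_⟩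
  rw [show 2 / (2 * (2 * R + 1) ^ (1 / a)) = ((2 * R + 1) ^ (1 / a))⁻¹ by field_simp,
    Real.inv_rpow (by positivity), ← Real.rpow_mul (by positivity), one_div_mul_cancel ha.ne',
    Real.rpow_one, ← div_eq_mul_inv, div_le_iff₀ (by positivity)]
  linarith

lemma pow_split {a g d : ℝ} (hd : 0 < d) (k : ℕ) :
    d ^ (a * k + g - 1) = d ^ (g - 1) * (d ^ a) ^ k := by
  rw [show a * k + g - 1 = (g - 1) + a * k by ring, Real.rpow_add hd, Real.rpow_mul hd.le,
    Real.rpow_natCast]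

lemma ml_term_le {a g c R x : ℝ} (ha : 0 < a) (hg : 1 ≤ g) (hc : 0 < c)
    (hR : R * (2 / c) ^ a ≤ 1 / 2) (hx : |x| ≤ R) (k : ℕ) :
    ‖x ^ k / Real.Gamma (a * k + g)‖ ≤ Real.exp c * (2 / c) ^ (g - 1) * (1 / 2) ^ k := by
  have hs : 1 ≤ a * k + g := by
    have : 0 ≤ a * (k : ℝ) := by positivity
    linarith
  have hG := Real.Gamma_pos_of_pos (by linarith : 0 < a * k + g)
  have h := inv_gamma_le hs hc
  rw [pow_split (by positivity)] at h
  rw [norm_div, norm_pow, Real.norm_eq_abs, Real.norm_of_nonneg hG.le, div_eq_mul_one_div]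
  calc |x| ^ k * (1 / Real.Gamma (a * k + g))
      ≤ R ^ k * (Real.exp c * ((2 / c) ^ (g - 1) * ((2 / c) ^ a) ^ k)) := by
        have : 0 ≤ R := (abs_nonneg x).trans hx
        gcongr
    _ = Real.exp c * (2 / c) ^ (g - 1) * (R * (2 / c) ^ a) ^ k := by rw [mul_pow]; ring
    _ ≤ _ := by
        have : 0 ≤ R := (abs_nonneg x).trans hx
        gcongr

lemma geo_summable (K : ℝ) : Summable fun k : ℕ => K * (1 / 2 : ℝ) ^ k :=
  (summable_geometric_of_lt_one (by norm_num) (by norm_num)).mul_left K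

lemma ml_summable_s9 {a g : ℝ} (ha : 0 < a) (hg : 1 ≤ g) (x : ℝ) :
    Summable fun k : ℕ => x ^ k / Real.Gamma (a * k + g) := by
  obtain ⟨c, hc, hR⟩ := exists_c ha (abs_nonneg x)
  exact Summable.of_norm_bounded (geo_summable _) (ml_term_le ha hg hc hR le_rfl)

lemma ml_imag_bound {b g x : ℝ} (h0 : 0 < b) (h1 : b < 1) (hg : 1 ≤ g) (hx : 0 ≤ x) :
    ‖∑' k : ℕ, (Complex.I * x) ^ k * ((1 / Real.Gamma (b * k + g) : ℝ) : ℂ)‖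
      ≤ 1 / Real.Gamma g := by
  obtain ⟨c, hc, hR⟩ := exists_c h0 hx
  have hs1 : ∀ k : ℕ, 1 ≤ b * k + g := fun k => by
    have : 0 ≤ b * (k : ℝ) := by positivity
    linarith
  -- the scaled discrete solution
  let F : ℕ → ℕ → ℂ := fun n k =>
    (Complex.I * x) ^ k * ((gc (b * k + g) n * (n : ℝ) ^ (1 - (b * k + g)) : ℝ) : ℂ)
  have hF : Filter.Tendsto (fun n => ∑' k, F n k) Filter.atTop
      (nhds (∑' k : ℕ, (Complex.I * x) ^ k * ((1 / Real.Gamma (b * k + g) : ℝ) : ℂ))) := by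
    refine tendsto_tsum_of_dominated_convergence
      (geo_summable (Real.exp c * (2 / c) ^ (g - 1))) ?_ ?_
    · intro k
      refine Filter.Tendsto.const_mul _ ?_
      exact (Complex.continuous_ofReal.tendsto _).comp (gc_tendsto (by linarith [hs1 k]))
    · filter_upwards [Filter.eventually_ge_atTop ⌈c⌉₊] with n hn k
      have hn' : c ≤ n := Nat.ceil_le.1 hn
      have h := gc_scaled_le (hs1 k) hc hn'
      rw [pow_split (by positivity)] at h
      have hp : 0 ≤ gc (b * k + g) n * (n : ℝ) ^ (1 - (b * k + g)) :=
        mul_nonneg (gc_nonneg (by linarith [hs1 k]) _) (by positivity)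
      simp only [F]
      rw [norm_mul, Complex.norm_real, Real.norm_of_nonneg hp, norm_pow, norm_mul, Complex.norm_I,
        one_mul, Complex.norm_real, Real.norm_of_nonneg hx]
      calc _ ≤ x ^ k * (Real.exp c * ((2 / c) ^ (g - 1) * ((2 / c) ^ b) ^ k)) := by gcongr
        _ = Real.exp c * (2 / c) ^ (g - 1) * (x * (2 / c) ^ b) ^ k := by rw [mul_pow]; ring
        _ ≤ _ := by gcongr
  refine le_of_tendsto_of_tendsto hF.norm (gc_tendsto (by linarith : 0 < g)) ?_
  filter_upwards [Filter.eventually_ge_atTop ⌈c⌉₊] with n hn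
  have hn' : c ≤ n := Nat.ceil_le.1 hn
  have hn0 : (0 : ℝ) < n := hc.trans_le hn'
  set μ : ℂ := Complex.I * ((x * (n : ℝ) ^ (-b) : ℝ) : ℂ) with hμ
  have hμn : ‖μ‖ = x * (n : ℝ) ^ (-b) := by
    rw [hμ, norm_mul, Complex.norm_I, one_mul, Complex.norm_real, Real.norm_of_nonneg (by positivity)]
  have hsum : ∀ m, m ≤ n → Summable fun k : ℕ => μ ^ k * (gc (b * k + g) m : ℂ) := by
    intro m hm
    refine Summable.of_norm_bounded (geo_summable (Real.exp c * (2 * n / c) ^ (g - 1))) fun k => ?_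
    have h := gc_le (hs1 k) hc hm hn'
    rw [pow_split (by positivity)] at h
    rw [norm_mul, norm_pow, hμn, Complex.norm_real,
      Real.norm_of_nonneg (gc_nonneg (by linarith [hs1 k]) _)]
    have e : x * (n : ℝ) ^ (-b) * (2 * n / c) ^ b = x * (2 / c) ^ b := by
      rw [show 2 * (n : ℝ) / c = 2 / c * n by ring, Real.mul_rpow (by positivity) hn0.le,
        Real.rpow_neg hn0.le]
      have : (n : ℝ) ^ b ≠ 0 := by positivity
      field_simp
    calc _ ≤ (x * (n : ℝ) ^ (-b)) ^ k *
          (Real.exp c * ((2 * n / c) ^ (g - 1) * ((2 * n / c) ^ b) ^ k)) := by gcongr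
      _ = Real.exp c * (2 * n / c) ^ (g - 1) * (x * (n : ℝ) ^ (-b) * (2 * n / c) ^ b) ^ k := by
          rw [mul_pow _ ((2 * n / c) ^ b)]; ring
      _ ≤ _ := by rw [e]; gcongr
  have hz := z_bound h0 h1 (by linarith) (μ := μ) (by simp [hμ]) hsum n le_rfl
  have hFe : ∑' k, F n k
      = (((n : ℝ) ^ (1 - g) : ℝ) : ℂ) * ∑' k : ℕ, μ ^ k * (gc (b * k + g) n : ℂ) := by
    rw [← tsum_mul_left]
    congr 1
    ext k
    simp only [F]
    rw [show 1 - (b * k + g) = (1 - g) + (-b) * k by ring, Real.rpow_add hn0, Real.rpow_mul hn0.le,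
      Real.rpow_natCast, hμ]
    push_cast
    rw [mul_pow, mul_pow, mul_pow]
    ring
  rw [hFe, norm_mul, Complex.norm_real, Real.norm_of_nonneg (by positivity), mul_comm]
  gcongr

lemma ml_continuous {a g : ℝ} (ha : 0 < a) (hg : 1 ≤ g) : Continuous (ML a g) := by
  rw [continuous_iff_continuousAt]
  intro x
  obtain ⟨c, hc, hR⟩ := exists_c ha (by positivity : 0 ≤ |x| + 1)
  have h : ContinuousOn (ML a g) {y | |y| ≤ |x| + 1} := by
    refine continuousOn_tsum (fun k => ?_) (geo_summable _)
      (fun k y hy => ml_term_le ha hg hc hR hy k)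
    fun_prop
  refine h.continuousAt ?_
  have : {y : ℝ | |y| < |x| + 1} ∈ nhds x :=
    (isOpen_lt continuous_abs continuous_const).mem_nhds (by simp)
  filter_upwards [this] with y hy using hy.le

lemma ml_zero (a : ℝ) : ML a 1 0 = 1 := by
  rw [ML, tsum_eq_single 0]
  · simp
  · intro k hk
    simp [hk]

lemma imag_summable {b g x : ℝ} (h0 : 0 < b) (hg : 1 ≤ g) :
    Summable fun k : ℕ => (Complex.I * x) ^ k * ((1 / Real.Gamma (b * k + g) : ℝ) : ℂ) := by
  refine Summable.of_norm ?_
  convert (ml_summable_s9 h0 hg x).norm using 2 with k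
  simp [div_eq_mul_inv]

lemma ml_one_bound {α x : ℝ} (h1 : 1 < α) (h2 : α < 2) (hx : 0 ≤ x) :
    |ML α 1 (-(x ^ 2))| ≤ 1 := by
  have h := ml_imag_bound (b := α / 2) (g := 1) (x := x) (by linarith) (by linarith) le_rfl hx
  have hs := imag_summable (b := α / 2) (g := 1) (x := x) (by linarith) le_rfl
  rw [Real.Gamma_one, div_one] at h
  refine le_trans (le_of_eq ?_) ((Complex.abs_re_le_norm _).trans h)
  congr 1
  rw [Complex.re_tsum hs, ML]
  symm
  rw [← (mul_right_injective₀ (two_ne_zero' ℕ)).tsum_eq]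
  · congr 1
    ext k
    have : (Complex.I * x) ^ (2 * k) = (((-(x ^ 2)) ^ k : ℝ) : ℂ) := by
      rw [pow_mul, mul_pow, Complex.I_sq]; push_cast; ring_nf
    rw [this, ← Complex.ofReal_mul, Complex.ofReal_re, mul_one_div]
    push_cast
    congr 3
    ring
  · intro k hk
    rw [Function.mem_support] at hk
    rcases Nat.even_or_odd k with ⟨j, hj⟩ | ⟨j, hj⟩
    · exact ⟨j, by simp only []; omega⟩
    · exfalso
      apply hk
      have : (Complex.I * x) ^ k = (((-(x ^ 2)) ^ j * x : ℝ) : ℂ) * Complex.I := by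
        rw [hj, pow_succ, pow_mul, mul_pow, Complex.I_sq]; push_cast; ring_nf
      rw [this, mul_right_comm, ← Complex.ofReal_mul, Complex.re_ofReal_mul, Complex.I_re, mul_zero]

lemma ml_two_bound {α x : ℝ} (h1 : 1 < α) (h2 : α < 2) (hx : 0 ≤ x) :
    |x * ML α 2 (-(x ^ 2))| ≤ 1 / Real.Gamma (2 - α / 2) := by
  have h := ml_imag_bound (b := α / 2) (g := 2 - α / 2) (x := x) (by linarith) (by linarith)
    (by linarith) hx
  have hs := imag_summable (b := α / 2) (g := 2 - α / 2) (x := x) (by linarith) (by linarith)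
  refine le_trans (le_of_eq ?_) ((Complex.abs_im_le_norm _).trans h)
  congr 1
  have hinj : Function.Injective fun k : ℕ => 2 * k + 1 := fun i j hij => by
    simp only [] at hij; omega
  rw [Complex.im_tsum hs, ML, ← tsum_mul_left]
  symm
  rw [← hinj.tsum_eq]
  · congr 1
    ext k
    have : (Complex.I * x) ^ (2 * k + 1) = (((-(x ^ 2)) ^ k * x : ℝ) : ℂ) * Complex.I := by
      rw [pow_succ, pow_mul, mul_pow, Complex.I_sq]; push_cast; ring_nf
    rw [this, mul_right_comm, ← Complex.ofReal_mul, Complex.im_ofReal_mul, Complex.I_im, mul_one,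
      mul_one_div]
    rw [show α / 2 * ((2 * k + 1 : ℕ) : ℝ) + (2 - α / 2) = α * k + 2 by push_cast; ring]
    ring
  · intro k hk
    rw [Function.mem_support] at hk
    rcases Nat.even_or_odd k with ⟨j, hj⟩ | ⟨j, hj⟩
    · exfalso
      apply hk
      have : (Complex.I * x) ^ k = (((-(x ^ 2)) ^ j : ℝ) : ℂ) := by
        rw [hj, ← two_mul, pow_mul, mul_pow, Complex.I_sq]; push_cast; ring_nf
      rw [this, ← Complex.ofReal_mul, Complex.ofReal_im]
    · exact ⟨j, by simp only []; omega⟩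

lemma coef_bound {α l t T p q : ℝ} (h1 : 1 < α) (h2 : α < 2) (hl : 0 < l) (ht0 : 0 ≤ t)
    (htT : t ≤ T) :
    l * (p * ML α 1 (-(l * t ^ α)) + q * (t * ML α 2 (-(l * t ^ α)))) ^ 2 ≤
      2 * (l * p ^ 2) + 2 * (1 / Real.Gamma (2 - α / 2)) ^ 2 * T ^ (2 - α) * q ^ 2 := by
  set x : ℝ := Real.sqrt l * t ^ (α / 2) with hx
  have hx2 : x ^ 2 = l * t ^ α := by
    rw [hx, mul_pow, Real.sq_sqrt hl.le, ← Real.rpow_natCast (t ^ (α / 2)), ← Real.rpow_mul ht0]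
    congr 2; push_cast; ring
  have hx0 : 0 ≤ x := by positivity
  rw [← hx2]
  have b1 := ml_one_bound h1 h2 hx0
  have b2 := ml_two_bound h1 h2 hx0
  set A := ML α 1 (-(x ^ 2))
  set B := ML α 2 (-(x ^ 2))
  set K := 1 / Real.Gamma (2 - α / 2)
  have a1 : A ^ 2 ≤ 1 := (sq_le_one_iff_abs_le_one A).2 b1
  have a2 : (x * B) ^ 2 ≤ K ^ 2 := sq_le_sq' (by linarith [(abs_le.1 b2).1]) (abs_le.1 b2).2
  have e : l * t ^ 2 = x ^ 2 * t ^ (2 - α) := by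
    rw [hx2, mul_assoc, ← Real.rpow_add_of_nonneg ht0 (by linarith) (by linarith)]
    congr 1
    rw [show α + (2 - α) = ((2 : ℕ) : ℝ) by push_cast; ring, Real.rpow_natCast]
  have hT : t ^ (2 - α) ≤ T ^ (2 - α) := Real.rpow_le_rpow ht0 htT (by linarith)
  have ht' : 0 ≤ t ^ (2 - α) := by positivity
  have a3 : l * (t * B) ^ 2 ≤ K ^ 2 * T ^ (2 - α) := by
    calc l * (t * B) ^ 2 = (x * B) ^ 2 * t ^ (2 - α) := by linear_combination B ^ 2 * e
      _ ≤ _ := by gcongr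
  calc l * (p * A + q * (t * B)) ^ 2
      ≤ l * (2 * (p * A) ^ 2 + 2 * (q * (t * B)) ^ 2) := by
        gcongr; nlinarith [sq_nonneg (p * A - q * (t * B))]
    _ = 2 * (l * p ^ 2) * A ^ 2 + 2 * q ^ 2 * (l * (t * B) ^ 2) := by ring
    _ ≤ 2 * (l * p ^ 2) * 1 + 2 * q ^ 2 * (K ^ 2 * T ^ (2 - α)) := by gcongr
    _ = _ := by ring

lemma unif_conv {H : Type*} [NormedAddCommGroup H] [InnerProductSpace ℝ H] [CompleteSpace H]
    (e : HilbertBasis ℕ ℝ H) (a : ℕ → ℝ → ℝ) (M : ℕ → ℝ) (hM : Summable M) (S : Set ℝ)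
    (h : ∀ n, ∀ t ∈ S, a n t ^ 2 ≤ M n) :
    TendstoUniformlyOn (fun (N : ℕ) (t : ℝ) => ∑ n ∈ Finset.range N, a n t • e n)
      (fun t => ∑' n, a n t • e n) Filter.atTop S := by
  have hsum : ∀ t ∈ S, Summable fun n => a n t • e n := by
    intro t ht
    have h2 : Summable fun n => a n t ^ 2 :=
      Summable.of_nonneg_of_le (fun n => sq_nonneg _) (fun n => h n t ht) hM
    have hmem : Memℓp (fun n => a n t) 2 := by
      rw [memℓp_gen_iff (by norm_num)]
      simpa using h2
    exact (e.hasSum_repr_symm ⟨fun n => a n t, hmem⟩).summable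
  have hfin : ∀ t ∈ S, ∀ s : Finset ℕ, ‖∑ n ∈ s, a n t • e n‖ ^ 2 ≤ ∑ n ∈ s, M n := by
    intro t ht s
    rw [← real_inner_self_eq_norm_sq, e.orthonormal.inner_sum]
    refine Finset.sum_le_sum fun n _ => ?_
    have := h n t ht
    simpa [sq] using this
  refine UniformCauchySeqOn.tendstoUniformlyOn_of_tendsto ?_
    (fun t ht => (hsum t ht).hasSum.tendsto_sum_nat)
  rw [Metric.uniformCauchySeqOn_iff]
  intro ε hε
  have hc := hM.hasSum.tendsto_sum_nat.cauchySeq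
  rw [Metric.cauchySeq_iff] at hc
  obtain ⟨N, hN⟩ := hc (ε ^ 2) (by positivity)
  refine ⟨N, ?_⟩
  have main : ∀ m ≥ N, ∀ n ≥ N, m ≤ n → ∀ t ∈ S,
      dist (∑ i ∈ Finset.range m, a i t • e i) (∑ i ∈ Finset.range n, a i t • e i) < ε := by
    intro m hm n hn hmn t ht
    have h1 := hN m hm n hn
    rw [dist_comm, Real.dist_eq, Finset.range_eq_Ico, Finset.range_eq_Ico,
      ← Finset.sum_Ico_consecutive M (Nat.zero_le m) hmn, add_sub_cancel_left] at h1
    have h2 := hfin t ht (Finset.Ico m n)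
    rw [dist_comm, dist_eq_norm, Finset.range_eq_Ico, Finset.range_eq_Ico,
      ← Finset.sum_Ico_consecutive _ (Nat.zero_le m) hmn, add_sub_cancel_left]
    exact lt_of_pow_lt_pow_left₀ 2 hε.le (h2.trans_lt ((le_abs_self _).trans_lt h1))
  intro m hm n hn t ht
  rcases le_total m n with hmn | hmn
  · exact main m hm n hn hmn t ht
  · rw [dist_comm]
    exact main n hn m hm hmn t ht

/-- Let `α ∈ (1,2)`. There is a constant `C > 0` depending only on `α` such that for every
separable Hilbert space `H` with orthonormal basis `(eₙ)`, every sequence `λₙ > 0` tending to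
`+∞`, every `T > 0`, `u₀ ∈ D(√A)` and `u₁ ∈ H`, the series
`u(t) = ∑ₙ [⟨u₀,eₙ⟩ E_{α,1}(−λₙtᵅ) + ⟨u₁,eₙ⟩ t E_{α,2}(−λₙtᵅ)] eₙ` converges in `D(√A)`
uniformly on `[0,T]` (i.e. the partial sums of the `√A`-image converge uniformly in `H`),
`u ∈ C([0,T];D(√A))`, `u(0) = u₀`, and `‖√A u(t)‖² ≤ C‖√A u₀‖² + C T^{2−α}‖u₁‖²` on `[0,T]`. -/
theorem weak_solution_series_regularity (α : ℝ) (hα1 : 1 < α) (hα2 : α < 2) :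
    ∃ C : ℝ, 0 < C ∧
      ∀ (H : Type*) [NormedAddCommGroup H] [InnerProductSpace ℝ H] [CompleteSpace H]
        (e : HilbertBasis ℕ ℝ H) (lam : ℕ → ℝ),
        (∀ n, 0 < lam n) →
        Filter.Tendsto lam Filter.atTop Filter.atTop →
        ∀ T : ℝ, 0 < T →
        ∀ u₀ u₁ : H, (Summable fun n => lam n * ⟪u₀, e n⟫ ^ 2) →
        let c : ℕ → ℝ → ℝ := fun n t =>
          ⟪u₀, e n⟫ * ML α 1 (-(lam n * t ^ α)) + ⟪u₁, e n⟫ * (t * ML α 2 (-(lam n * t ^ α)))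
        (∀ t ∈ Set.Icc (0 : ℝ) T, Summable fun n => lam n * c n t ^ 2) ∧
        TendstoUniformlyOn
          (fun (N : ℕ) (t : ℝ) => ∑ n ∈ Finset.range N, (Real.sqrt (lam n) * c n t) • e n)
          (fun t => ∑' n, (Real.sqrt (lam n) * c n t) • e n)
          Filter.atTop (Set.Icc (0 : ℝ) T) ∧
        ContinuousOn (fun t => ∑' n, (Real.sqrt (lam n) * c n t) • e n) (Set.Icc (0 : ℝ) T) ∧
        (∑' n, c n 0 • e n) = u₀ ∧
        ∀ t ∈ Set.Icc (0 : ℝ) T,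
          (∑' n, lam n * c n t ^ 2) ≤
            C * (∑' n, lam n * ⟪u₀, e n⟫ ^ 2) + C * T ^ (2 - α) * ‖u₁‖ ^ 2 := by
  set K : ℝ := 1 / Real.Gamma (2 - α / 2) with hK
  refine ⟨2 + 2 * K ^ 2, by positivity, ?_⟩
  intro H _ _ _ e lam hlam _ T hT u₀ u₁ hu₀ c
  have hpars : HasSum (fun n => ⟪u₁, e n⟫ ^ 2) (‖u₁‖ ^ 2) := by
    have h := e.hasSum_inner_mul_inner u₁ u₁
    rw [real_inner_self_eq_norm_sq] at h
    refine h.congr_fun fun n => ?_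
    rw [sq, real_inner_comm u₁ (e n)]
  set M : ℕ → ℝ := fun n =>
    2 * (lam n * ⟪u₀, e n⟫ ^ 2) + 2 * K ^ 2 * T ^ (2 - α) * ⟪u₁, e n⟫ ^ 2 with hMdef
  have hMsum : HasSum M (2 * (∑' n, lam n * ⟪u₀, e n⟫ ^ 2) + 2 * K ^ 2 * T ^ (2 - α) * ‖u₁‖ ^ 2) :=
    (hu₀.hasSum.mul_left 2).add (hpars.mul_left _)
  have hb : ∀ n, ∀ t ∈ Set.Icc (0 : ℝ) T, lam n * c n t ^ 2 ≤ M n := fun n t ht =>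
    coef_bound hα1 hα2 (hlam n) ht.1 ht.2
  have hsm : ∀ t ∈ Set.Icc (0 : ℝ) T, Summable fun n => lam n * c n t ^ 2 := fun t ht =>
    Summable.of_nonneg_of_le (fun n => mul_nonneg (hlam n).le (sq_nonneg _))
      (fun n => hb n t ht) hMsum.summable
  have hunif : TendstoUniformlyOn
      (fun (N : ℕ) (t : ℝ) => ∑ n ∈ Finset.range N, (Real.sqrt (lam n) * c n t) • e n)
      (fun t => ∑' n, (Real.sqrt (lam n) * c n t) • e n)
      Filter.atTop (Set.Icc (0 : ℝ) T) := by
    refine unif_conv e (fun n t => Real.sqrt (lam n) * c n t) M hMsum.summable _ ?_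
    intro n t ht
    rw [mul_pow, Real.sq_sqrt (hlam n).le]
    exact hb n t ht
  have hcont : ∀ n, Continuous (c n) := by
    intro n
    have hp : Continuous fun t : ℝ => -(lam n * t ^ α) :=
      ((Real.continuous_rpow_const (by linarith)).const_mul _).neg
    have m1 := (ml_continuous (a := α) (g := 1) (by linarith) le_rfl).comp hp
    have m2 := (ml_continuous (a := α) (g := 2) (by linarith) (by norm_num)).comp hp
    exact (m1.const_mul _).add ((continuous_id.mul m2).const_mul _)
  refine ⟨hsm, hunif, ?_, ?_, ?_⟩
  · refine hunif.continuousOn (Filter.Frequently.of_forall fun N => Continuous.continuousOn ?_)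
    exact continuous_finsetSum _ fun n _ => ((hcont n).const_mul _).smul continuous_const
  · have h0 : ∀ n, c n 0 = e.repr u₀ n := by
      intro n
      simp only [c]
      rw [Real.zero_rpow (by linarith), mul_zero, neg_zero, ml_zero, zero_mul, mul_zero, mul_one,
        add_zero, e.repr_apply_apply, real_inner_comm]
    simp only [h0]
    exact (e.hasSum_repr u₀).tsum_eq
  · intro t ht
    have h1 : (∑' n, lam n * c n t ^ 2) ≤ _ :=
      hasSum_le (fun n => hb n t ht) (hsm t ht).hasSum hMsum
    have p0 : 0 ≤ ∑' n, lam n * ⟪u₀, e n⟫ ^ 2 :=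
      tsum_nonneg fun n => mul_nonneg (hlam n).le (sq_nonneg _)
    have p1 : 0 ≤ T ^ (2 - α) * ‖u₁‖ ^ 2 := by positivity
    nlinarith [mul_nonneg (sq_nonneg K) p0]
end

section
/- Let α ∈ (1,2), T > 0, u₀ ∈ D(√A), u₁ ∈ H, and let u'(t) = Σ_{n=1}^∞ [ −λ_n ⟨u₀,e_n⟩ t^{α−1} E_{α,α}(−λ_n t^α) + ⟨u₁,e_n⟩ E_{α,1}(−λ_n t^α) ] e_n. Then the Riemann–Liouville integral of u' − u₁ of order 2−α satisfies I^{2−α}(u' − u₁)(t) = −Σ_{n=1}^∞ λ_n [ ⟨u₀,e_n⟩ t E_{α,2}(−λ_n t^α) + ⟨u₁,e_n⟩ t² E_{α,3}(−λ_n t^α) ] e_n for all t ∈ [0,T], and this function belongs to C([0,T]; H). -/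
open scoped RealInnerProductSpace

/-- The Riemann–Liouville fractional integral of order `β` of an `H`-valued function:
`I^β(f)(t) = (1/Γ(β)) ∫_0^t (t−τ)^{β−1} f(τ) dτ`. -/
noncomputable def riemannLiouville {H : Type*} [NormedAddCommGroup H] [NormedSpace ℝ H]
    (β : ℝ) (f : ℝ → H) (t : ℝ) : H :=
  (Real.Gamma β)⁻¹ • ∫ τ in (0 : ℝ)..t, ((t - τ) ^ (β - 1)) • f τ


open MeasureTheory Set Filter Topology

namespace RLproof

lemma beta_int {p q t : ℝ} (hp : 0 < p) (hq : 0 < q) (ht : 0 < t) :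
    ∫ s in (0:ℝ)..t, (t - s) ^ (q - 1) * s ^ (p - 1) =
      Real.Gamma q * Real.Gamma p / Real.Gamma (p + q) * t ^ (p + q - 1) := by
  have h1 := Complex.betaIntegral_scaled (p : ℂ) (q : ℂ) ht
  rw [Complex.betaIntegral_eq_Gamma_mul_div _ _ (by simpa) (by simpa)] at h1
  have h2 : ∫ x in (0:ℝ)..t, (x : ℂ) ^ ((p:ℂ) - 1) * ((t : ℂ) - x) ^ ((q:ℂ) - 1) =
      ((∫ s in (0:ℝ)..t, (t - s) ^ (q - 1) * s ^ (p - 1) : ℝ) : ℂ) := by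
    rw [← intervalIntegral.integral_ofReal]
    refine intervalIntegral.integral_congr fun s hs => ?_
    rw [uIcc_of_le ht.le] at hs
    have := hs.1
    have := hs.2
    push_cast
    rw [Complex.ofReal_cpow (by linarith), Complex.ofReal_cpow (by linarith)]
    push_cast
    ring
  rw [h2] at h1
  have h3 : ((t:ℂ) ^ ((p:ℂ) + q - 1) * (Complex.Gamma p * Complex.Gamma q / Complex.Gamma (p + q)))
      = ((Real.Gamma q * Real.Gamma p / Real.Gamma (p + q) * t ^ (p + q - 1) : ℝ) : ℂ) := by
    push_cast
    rw [Complex.ofReal_cpow ht.le, ← Complex.Gamma_ofReal, ← Complex.Gamma_ofReal,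
      ← Complex.Gamma_ofReal]
    push_cast
    ring
  rw [h3] at h1
  exact_mod_cast h1

lemma beta_intble {p q t : ℝ} (hp : 0 < p) (hq : 0 < q) (ht : 0 < t) :
    IntervalIntegrable (fun s => (t - s) ^ (q - 1) * s ^ (p - 1)) volume 0 t := by
  apply intervalIntegral.intervalIntegrable_of_integral_ne_zero
  rw [beta_int hp hq ht]
  have := Real.Gamma_pos_of_pos hp
  have := Real.Gamma_pos_of_pos hq
  have := Real.Gamma_pos_of_pos (add_pos hp hq)
  positivity

lemma beta_intble' {p q t : ℝ} (hp : 0 < p) (hq : 0 < q) (ht : 0 < t) {h : ℝ → ℝ}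
    (hh : ContinuousOn h (Icc 0 t)) :
    IntervalIntegrable (fun s => (t - s) ^ (q - 1) * (s ^ (p - 1) * h s)) volume 0 t := by
  have := (beta_intble hp hq ht).mul_continuousOn (g := h) (by rwa [uIcc_of_le ht.le])
  simpa [mul_assoc] using this

lemma gamma_arg_pos {α β : ℝ} (hα : 1 < α) (hβ : 0 < β) (k : ℕ) : 0 < α * (k:ℝ) + β := by
  positivity

lemma ml_summable {α β : ℝ} (hα : 1 < α) (hβ : 0 < β) (x : ℝ) :
    Summable fun k : ℕ => x ^ k / Real.Gamma (α * (k : ℝ) + β) := by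
  rw [← summable_nat_add_iff 2]
  have hs : Summable fun k : ℕ => |x| ^ 2 * (|x| ^ k / (k.factorial : ℝ)) :=
    (Real.summable_pow_div_factorial |x|).mul_left _
  refine Summable.of_norm_bounded hs fun k => ?_
  have hk : (0:ℝ) ≤ k := Nat.cast_nonneg k
  have h1 : Real.Gamma ((k + 1 : ℕ) + 1) ≤ Real.Gamma (α * ((k + 2 : ℕ) : ℝ) + β) := by
    apply Real.Gamma_strictMonoOn_Ici.monotoneOn
    · simp only [mem_Ici]; push_cast; linarith
    · simp only [mem_Ici]; push_cast; nlinarith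
    · push_cast; nlinarith
  rw [Real.Gamma_nat_eq_factorial] at h1
  have h2 : (k.factorial : ℝ) ≤ ((k+1).factorial : ℝ) := by
    exact_mod_cast Nat.factorial_le (Nat.le_succ k)
  have h3 : (0:ℝ) < k.factorial := by positivity
  rw [norm_div, norm_pow, Real.norm_eq_abs, Real.norm_eq_abs, abs_of_pos (a := Real.Gamma _) (by linarith),
    ← mul_div_assoc, ← pow_add, add_comm 2 k]
  gcongr
  linarith

lemma ml_continuous {α β : ℝ} (hα : 1 < α) (hβ : 0 < β) : Continuous (ML α β) := by
  rw [continuous_iff_continuousAt]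
  intro x
  have : ContinuousOn (ML α β) (Metric.ball 0 (|x| + 1)) := by
    unfold ML
    refine continuousOn_tsum (u := fun k : ℕ => (|x|+1) ^ k / Real.Gamma (α * (k : ℝ) + β)) ?_
      (ml_summable hα hβ _) ?_
    · intro k
      fun_prop
    · intro k y hy
      have hp := Real.Gamma_pos_of_pos (gamma_arg_pos hα hβ k)
      rw [norm_div, norm_pow, Real.norm_of_nonneg hp.le]
      have : ‖y‖ < |x| + 1 := by simpa using hy
      gcongr
  refine this.continuousAt (Metric.isOpen_ball.mem_nhds ?_)
  simp

/-- `t^(β-1) E_{α,β}(-l t^α)` -/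
noncomputable def F (α l β s : ℝ) : ℝ := s ^ (β - 1) * ML α β (-(l * s ^ α))

lemma mlc {α β : ℝ} (l : ℝ) (hα : 1 < α) (hβ : 0 < β) :
    Continuous fun s : ℝ => ML α β (-(l * s ^ α)) := by
  refine (ml_continuous hα hβ).comp ?_
  have : Continuous fun s : ℝ => s ^ α := Real.continuous_rpow_const (by linarith)
  fun_prop

lemma F_int {α l β b t : ℝ} (hα : 1 < α) (hβ : 0 < β) (hb : 0 < b) (ht : 0 < t) :
    ∫ s in (0:ℝ)..t, (t - s) ^ (b - 1) * F α l β s = Real.Gamma b * F α l (β + b) t := by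
  set f : ℕ → ℝ → ℝ := fun k s => ((-l) ^ k / Real.Gamma (α * (k:ℝ) + β)) *
    ((t - s) ^ (b - 1) * s ^ (α * k + β - 1)) with hf
  have hI : ∀ k : ℕ, ∀ c : ℝ, c * ∫ s in Ioc 0 t, ((t - s) ^ (b - 1) * s ^ (α * k + β - 1)) =
      Real.Gamma b * t ^ (β + b - 1) *
        ((c * Real.Gamma (α * (k:ℝ) + β)) * (t ^ α) ^ k / Real.Gamma (α * k + (β + b))) := by
    intro k c
    rw [← intervalIntegral.integral_of_le ht.le, beta_int (gamma_arg_pos hα hβ k) hb ht,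
      show α * k + β + b - 1 = α * k + (β + b - 1) by ring, Real.rpow_add ht, Real.rpow_mul ht.le,
      Real.rpow_natCast, show α * (k:ℝ) + β + b = α * k + (β + b) by ring]
    ring
  have hG : ∀ k : ℕ, Real.Gamma (α * (k:ℝ) + β) ≠ 0 := fun k =>
    (Real.Gamma_pos_of_pos (gamma_arg_pos hα hβ k)).ne'
  have hIntg : ∀ k, Integrable (f k) (volume.restrict (Ioc 0 t)) := by
    intro k
    have := (beta_intble (gamma_arg_pos hα hβ k) hb ht).const_mul
      ((-l) ^ k / Real.Gamma (α * (k:ℝ) + β))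
    rwa [intervalIntegrable_iff_integrableOn_Ioc_of_le ht.le] at this
  have hfint : ∀ k, ∫ s in Ioc 0 t, f k s = Real.Gamma b * t ^ (β + b - 1) *
      ((-(l * t ^ α)) ^ k / Real.Gamma (α * k + (β + b))) := by
    intro k
    simp only [hf]
    rw [integral_const_mul, hI, div_mul_cancel₀ _ (hG k), ← mul_pow]
    ring_nf
  have hnorm : ∀ k, ∫ s in Ioc 0 t, ‖f k s‖ = Real.Gamma b * t ^ (β + b - 1) *
      ((|l| * t ^ α) ^ k / Real.Gamma (α * k + (β + b))) := by
    intro k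
    have : ∫ s in Ioc 0 t, ‖f k s‖ = ∫ s in Ioc 0 t, (|l| ^ k / Real.Gamma (α * (k:ℝ) + β)) *
        ((t - s) ^ (b - 1) * s ^ (α * k + β - 1)) := by
      refine setIntegral_congr_fun measurableSet_Ioc fun s hs => ?_
      have h1 : 0 ≤ t - s := by linarith [hs.2]
      have h2 : 0 ≤ s := hs.1.le
      simp only [hf]
      rw [norm_mul, norm_div, norm_pow, norm_neg, Real.norm_eq_abs,
        Real.norm_of_nonneg (Real.Gamma_pos_of_pos (gamma_arg_pos hα hβ k)).le,
        Real.norm_of_nonneg (by positivity)]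
    rw [this, integral_const_mul, hI, div_mul_cancel₀ _ (hG k), ← mul_pow]
  have key := hasSum_integral_of_summable_integral_norm hIntg (by
    simp_rw [hnorm]
    exact (ml_summable hα (by linarith) _).mul_left _)
  simp_rw [hfint] at key
  have e1 : Real.Gamma b * F α l (β + b) t = ∑' k : ℕ, Real.Gamma b * t ^ (β + b - 1) *
      ((-(l * t ^ α)) ^ k / Real.Gamma (α * k + (β + b))) := by
    rw [tsum_mul_left, F, ML]
    ring
  rw [e1, key.tsum_eq, intervalIntegral.integral_of_le ht.le]
  refine setIntegral_congr_fun measurableSet_Ioc fun s hs => ?_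
  have h2 : 0 < s := hs.1
  simp only [F, ML, hf]
  rw [← tsum_mul_left, ← tsum_mul_left]
  refine tsum_congr fun k => ?_
  rw [show α * k + β - 1 = α * k + (β - 1) by ring, Real.rpow_add h2, Real.rpow_mul h2.le,
      Real.rpow_natCast, ← neg_mul, mul_pow]
  ring

lemma F_int_one {α l β t : ℝ} (hα : 1 < α) (hβ : 0 < β) (ht : 0 ≤ t) :
    ∫ s in (0:ℝ)..t, F α l β s = F α l (β + 1) t := by
  rcases ht.eq_or_lt with rfl | ht
  · simp [F, hβ.ne']
  · simpa using F_int (b := 1) (l := l) hα hβ one_pos ht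

lemma F_rec {α l β t : ℝ} (hα : 1 < α) (hβ : 0 < β) (ht : 0 < t) :
    F α l β t = t ^ (β - 1) / Real.Gamma β - l * F α l (β + α) t := by
  simp only [F, ML]
  rw [(ml_summable hα hβ _).tsum_eq_zero_add, mul_add, sub_eq_add_neg]
  congr 1
  · simp; ring
  · rw [← tsum_mul_left, ← tsum_mul_left, ← tsum_mul_left, ← tsum_neg]
    refine tsum_congr fun k => ?_
    rw [show β + α - 1 = (β - 1) + α by ring, Real.rpow_add ht (β - 1) α,
      show α * ((k + 1 : ℕ) : ℝ) + β = α * k + (β + α) by push_cast; ring, pow_succ]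
    ring

lemma F_cont {α l β : ℝ} (hα : 1 < α) (hβ : 1 ≤ β) : Continuous (F α l β) := by
  have h1 := mlc (β := β) l hα (by linarith)
  have : Continuous fun s : ℝ => s ^ (β - 1) := Real.continuous_rpow_const (by linarith)
  exact this.mul h1

lemma F_contAt {α l β t : ℝ} (hα : 1 < α) (hβ : 0 < β) (ht : 0 < t) :
    ContinuousAt (F α l β) t := by
  have h1 := mlc (β := β) l hα (by linarith)
  exact (Real.continuousAt_rpow_const t (β - 1) (Or.inl ht.ne')).mul h1.continuousAt

lemma F_intble {α l β t : ℝ} (hα : 1 < α) (hβ : 0 < β) (ht : 0 < t) :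
    IntervalIntegrable (F α l β) volume 0 t := by
  have := beta_intble' (q := 1) hβ one_pos ht (mlc (β := β) l hα hβ).continuousOn
  unfold F
  simpa using this

lemma F_deriv {α l β t : ℝ} (hα : 1 < α) (hβ : 0 < β) (ht : 0 < t) :
    HasDerivAt (F α l (β + 1)) (F α l β t) t := by
  have hm : Measurable (F α l β) := by
    unfold F
    exact (by fun_prop : Measurable fun s : ℝ => s ^ (β - 1)).mul (mlc l hα hβ).measurable
  have := intervalIntegral.integral_hasDerivAt_right (F_intble (l := l) hα hβ ht)
    (hm.stronglyMeasurable.stronglyMeasurableAtFilter) (F_contAt hα hβ ht)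
  refine this.congr_of_eventuallyEq ?_
  filter_upwards [lt_mem_nhds ht] with s hs
  exact (F_int_one hα hβ (le_of_lt hs)).symm

end RLproof

namespace RLproof

lemma alik {α l t : ℝ} (hα : 1 < α) (hα2 : α < 2) (ht : 0 < t) :
    0 ≤ ∫ s in (0:ℝ)..t, (t - s) ^ (2 - α - 1) *
      ((F α l α t - F α l α s) * F α l (α - 1) s) := by
  set z := F α l α with hz
  set z' := F α l (α - 1) with hz'
  have hzc : Continuous z := F_cont hα hα.le
  have hzd : ∀ s, 0 < s → HasDerivAt z (z' s) s := by
    intro s hs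
    have := F_deriv (l := l) hα (show 0 < α - 1 by linarith) hs
    simpa using this
  set g : ℝ → ℝ := fun s => -((t - s) ^ (3 - α) * (dslope z t s) ^ 2 / 2) with hg
  have hg_eq : ∀ s, s < t → g s = -((t - s) ^ (2 - α - 1) * (z t - z s) ^ 2 / 2) := by
    intro s hs
    have h1 : 0 < t - s := by linarith
    simp only [hg]
    rw [dslope_of_ne _ hs.ne, slope_def_field, show 3 - α = (2 - α - 1) + 2 by ring,
      Real.rpow_add h1, div_pow, show (s - t)^2 = (t-s)^2 by ring, Real.rpow_two]
    field_simp
    ring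
  have hcont : ContinuousOn g (Icc 0 t) := by
    have hd : ContinuousOn (dslope z t) (Icc 0 t) := by
      intro s hs
      rcases hs.2.eq_or_lt with rfl | h
      · exact (continuousAt_dslope_same.2 (hzd s ht).differentiableAt).continuousWithinAt
      · exact ((continuousAt_dslope_of_ne h.ne).2 hzc.continuousAt).continuousWithinAt
    have h2 : Continuous fun s : ℝ => (t - s) ^ (3 - α) :=
      (Real.continuous_rpow_const (by linarith)).comp (by fun_prop)
    exact ((h2.continuousOn.mul (hd.pow 2)).div_const 2).neg
  have key := intervalIntegral.sub_le_integral_of_hasDeriv_right_of_le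
    (g := g) (a := 0) (b := t)
    (φ := fun s => (t - s) ^ (2 - α - 1) * ((z t - z s) * z' s))
    (g' := fun s => -(((-1) * (2 - α - 1) * (t - s) ^ (2 - α - 1 - 1)) * (z t - z s) ^ 2 / 2 +
      (t - s) ^ (2 - α - 1) * (2 * (z t - z s) * (-(z' s))) / 2)) ht.le hcont ?_ ?_ ?_
  · have h0 : g t = 0 := by simp [hg, Real.zero_rpow (show 3 - α ≠ 0 by linarith)]
    have h1 : g 0 ≤ 0 := by
      rw [hg_eq 0 ht]
      have : 0 ≤ (t - 0) ^ (2 - α - 1) := Real.rpow_nonneg (by linarith) _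
      have := mul_nonneg this (sq_nonneg (z t - z 0))
      linarith
    linarith
  · intro s hs
    have hs1 : 0 < t - s := by linarith [hs.2]
    apply HasDerivAt.hasDerivWithinAt
    have hA : HasDerivAt (fun s => (t - s) ^ (2 - α - 1))
        ((-1) * (2 - α - 1) * (t - s) ^ (2 - α - 1 - 1)) s :=
      ((hasDerivAt_id s).const_sub t).rpow_const (Or.inl hs1.ne')
    have hB : HasDerivAt (fun s => (z t - z s) ^ 2) (2 * (z t - z s) * (-(z' s))) s := by
      have := ((hzd s hs.1).const_sub (z t)).fun_pow 2
      simpa using this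
    have := ((hA.mul hB).div_const 2).neg
    have h3 := this.congr_of_eventuallyEq (f₁ := g) (by
      filter_upwards [gt_mem_nhds hs.2] with r hr
      exact hg_eq r hr)
    convert h3 using 1
    ring
  · have h1 : ContinuousOn (fun s => (z t - z s) * ML α (α - 1) (-(l * s ^ α))) (Icc 0 t) :=
      ((continuous_const.sub hzc).mul (mlc l hα (by linarith))).continuousOn
    have := beta_intble' (p := α - 1) (q := 2 - α) (by linarith) (by linarith) ht h1
    rw [intervalIntegrable_iff_integrableOn_Icc_of_le ht.le] at this
    refine this.congr_fun (fun s _ => ?_) measurableSet_Icc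
    simp only [hz', F]
    ring
  · intro s hs
    have hs1 : 0 < t - s := by linarith [hs.2]
    have h2 : 0 ≤ (t - s) ^ (2 - α - 1 - 1) := Real.rpow_nonneg hs1.le _
    have : 0 ≤ (α - 1) * ((t - s) ^ (2 - α - 1 - 1) * (z t - z s) ^ 2) :=
      mul_nonneg (by linarith) (mul_nonneg h2 (sq_nonneg _))
    linarith

lemma int_pow {q a b : ℝ} (hq : 0 < q) (hab : a ≤ b) :
    ∫ t in Ioc a b, (t - a) ^ (q - 1) = (b - a) ^ q / q := by
  rw [← intervalIntegral.integral_of_le hab,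
    intervalIntegral.integral_comp_sub_right (fun x => x ^ (q - 1)), 
    integral_rpow (Or.inl (by linarith))]
  simp [Real.zero_rpow hq.ne']

lemma int_pow_on {q a b : ℝ} (hq : 0 < q) (hab : a ≤ b) :
    IntegrableOn (fun t => (t - a) ^ (q - 1)) (Ioc a b) := by
  rw [← intervalIntegrable_iff_integrableOn_Ioc_of_le hab]
  have := (intervalIntegral.intervalIntegrable_rpow' (a := 0) (b := b - a)
    (show -1 < q - 1 by linarith)).comp_sub_right a
  simpa using this

lemma fubini {q T : ℝ} (hq : 0 < q) (hT : 0 < T) {f : ℝ → ℝ}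
    (hf : IntegrableOn f (Ioc 0 T)) :
    IntegrableOn (fun t => ∫ s in (0:ℝ)..t, (t - s) ^ (q - 1) * f s) (Ioc 0 T) ∧
    ∫ t in (0:ℝ)..T, ∫ s in (0:ℝ)..t, (t - s) ^ (q - 1) * f s =
      ∫ s in (0:ℝ)..T, (T - s) ^ q / q * f s := by
  set μ : Measure ℝ := volume.restrict (Ioc 0 T) with hμ
  set K : ℝ → ℝ → ℝ := fun t s => (Ioi (0:ℝ)).indicator (fun r => r ^ (q - 1)) (t - s) with hK
  have hKm : Measurable (Function.uncurry K) := by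
    have : Measurable ((Ioi (0:ℝ)).indicator (fun r : ℝ => r ^ (q - 1))) :=
      Measurable.indicator (by fun_prop) measurableSet_Ioi
    exact this.comp (by fun_prop : Measurable fun p : ℝ × ℝ => p.1 - p.2)
  have hKn : ∀ t s, 0 ≤ K t s := by
    intro t s
    refine indicator_nonneg (fun r hr => Real.rpow_nonneg (le_of_lt hr) _) _
  have hKs : ∀ s, (fun t => K t s) = (Ioi s).indicator (fun t => (t - s) ^ (q - 1)) := by
    intro s
    ext t
    simp [hK, indicator]
  have hKint : ∀ s ∈ Ioc 0 T, Integrable (fun t => K t s) μ := by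
    intro s hs
    rw [hKs, hμ, integrable_indicator_iff measurableSet_Ioi, IntegrableOn, Measure.restrict_restrict measurableSet_Ioi]
    refine (int_pow_on hq hs.2).mono_set ?_
    intro x hx
    exact ⟨hx.1, hx.2.2⟩
  have hKval : ∀ s ∈ Ioc 0 T, ∫ t, K t s ∂μ = (T - s) ^ q / q := by
    intro s hs
    rw [hKs, hμ, integral_indicator measurableSet_Ioi, Measure.restrict_restrict measurableSet_Ioi,
      ← int_pow hq hs.2]
    congr 2
    ext x
    constructor
    · intro hx
      exact ⟨hx.1, hx.2.2⟩
    · intro hx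
      exact ⟨hx.1, hs.1.trans hx.1, hx.2⟩
  have hpow : ContinuousOn (fun s : ℝ => (T - s) ^ q / q) (Icc 0 T) := by
    have h2 : Continuous fun s : ℝ => (T - s) ^ q :=
      (Real.continuous_rpow_const hq.le).comp (by fun_prop)
    exact (h2.div_const q).continuousOn
  have hIntg : Integrable (Function.uncurry fun t s => K t s * f s) (μ.prod μ) := by
    rw [integrable_prod_iff']
    · constructor
      · filter_upwards [ae_restrict_mem measurableSet_Ioc] with s hs
        exact (hKint s hs).mul_const (f s)
      · have h1 : Integrable (fun s => (T - s) ^ q / q * ‖f s‖) μ := by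
          have hb : IntegrableOn (fun s => ‖f s‖) (Icc 0 T) := by
            rw [integrableOn_Icc_iff_integrableOn_Ioc]; exact hf.norm
          have := hb.continuousOn_mul hpow isCompact_Icc
          exact this.mono_set Ioc_subset_Icc_self
        refine h1.congr ?_
        filter_upwards [ae_restrict_mem measurableSet_Ioc] with s hs
        rw [← hKval s hs, ← integral_mul_const]
        congr 1
        ext t
        simp [abs_of_nonneg (hKn t s)]
    · exact (hKm.aestronglyMeasurable).mul hf.1.comp_snd
  have hin : ∀ t ∈ Ioc 0 T, ∫ s, K t s * f s ∂μ = ∫ s in (0:ℝ)..t, (t - s) ^ (q - 1) * f s := by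
    intro t ht
    have : (fun s => K t s * f s) = (Iio t).indicator (fun s => (t - s) ^ (q - 1) * f s) := by
      ext s
      by_cases h : s < t <;> simp [hK, indicator, h]
    rw [this, integral_indicator measurableSet_Iio, hμ, Measure.restrict_restrict measurableSet_Iio,
      intervalIntegral.integral_of_le ht.1.le, integral_Ioc_eq_integral_Ioo]
    congr 2
    ext x
    constructor
    · intro hx
      exact ⟨hx.2.1, hx.1⟩
    · intro hx
      exact ⟨hx.2, hx.1, (le_of_lt hx.2).trans ht.2⟩
  constructor
  · refine hIntg.integral_prod_left.congr ?_
    filter_upwards [ae_restrict_mem measurableSet_Ioc] with t ht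
    exact hin t ht
  · have := integral_integral_swap hIntg
    rw [intervalIntegral.integral_of_le hT.le, intervalIntegral.integral_of_le hT.le]
    calc _ = ∫ t in Ioc 0 T, ∫ s, K t s * f s ∂μ := by
            refine setIntegral_congr_fun measurableSet_Ioc fun t ht => ?_
            exact (hin t ht).symm
      _ = _ := this
      _ = _ := by
            refine setIntegral_congr_fun measurableSet_Ioc fun s hs => ?_
            rw [integral_mul_const, hKval s hs]

lemma energy {α l T : ℝ} (hα : 1 < α) (hα2 : α < 2) (hl : 0 < l) (hT : 0 < T) :
    l * ∫ s in (0:ℝ)..T, (T - s) ^ (2 - α - 1) * (F α l α s) ^ 2 ≤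
      Real.Gamma (2 - α) * (1 - (F α l 1 T) ^ 2) := by
  have hα1 : 0 < α - 1 := by linarith
  have hq : 0 < 2 - α := by linarith
  set z := F α l α with hz
  set z' := F α l (α - 1) with hz'
  set y := F α l 1 with hy
  have hzc : Continuous z := F_cont hα hα.le
  have hyc : Continuous y := F_cont hα le_rfl
  have hzd : ∀ s, 0 < s → HasDerivAt z (z' s) s := by
    intro s hs
    have := F_deriv (l := l) hα hα1 hs
    simpa using this
  have hyd : ∀ s, 0 < s → HasDerivAt y (-(l * z s)) s := by
    intro s hs
    have h1 := ((F_deriv (l := l) hα (show 0 < α by linarith) hs).const_mul l).const_sub 1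
    refine h1.congr_of_eventuallyEq ?_
    filter_upwards [lt_mem_nhds hs] with r hr
    rw [hy, F_rec hα one_pos hr, add_comm]
    simp
  have hy0 : y 0 = 1 := by
    have : ML α 1 0 = 1 := by
      rw [ML, tsum_eq_single 0]
      · simp
      · intro k hk; simp [hk]
    simp [hy, F, Real.zero_rpow (show α ≠ 0 by linarith), this]
  have hz0 : z 0 = 0 := by
    simp [hz, F, Real.zero_rpow hα1.ne']
  -- integral of z y
  have hzy : ∫ s in (0:ℝ)..T, -(2 * l) * (z s * y s) = y T ^ 2 - 1 := by
    have := intervalIntegral.integral_eq_sub_of_hasDerivAt_of_le (f := fun s => y s ^ 2)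
      (f' := fun s => -(2 * l) * (z s * y s)) hT.le (hyc.pow 2).continuousOn ?_
      (by apply Continuous.intervalIntegrable; fun_prop)
    · rw [this, hy0]; simp
    · intro s hs
      have := (hyd s hs.1).fun_pow 2
      refine this.congr_deriv ?_
      push_cast; ring
  rw [intervalIntegral.integral_const_mul] at hzy
  have hff : IntegrableOn (fun s => z s * z' s) (Ioc 0 T) := by
    have h1 : IntegrableOn z' (Icc 0 T) := by
      rw [← intervalIntegrable_iff_integrableOn_Icc_of_le hT.le]
      exact F_intble hα hα1 hT
    exact (h1.continuousOn_mul hzc.continuousOn isCompact_Icc).mono_set Ioc_subset_Icc_self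
  obtain ⟨hKi, hKv⟩ := fubini hq hT hff
  -- pointwise inequality
  have hpt : ∀ t ∈ Ioc 0 T, ∫ s in (0:ℝ)..t, (t - s) ^ (2 - α - 1) * (z s * z' s) ≤
      Real.Gamma (2 - α) * (z t * y t) := by
    intro t ht
    have h1 := alik (l := l) hα hα2 ht.1
    have h2 := F_int (l := l) (t := t) hα hα1 hq ht.1
    rw [show α - 1 + (2 - α) = 1 by ring] at h2
    have i1 : IntervalIntegrable (fun s => (t - s) ^ (2 - α - 1) * z' s) volume 0 t := 
      beta_intble' hα1 hq ht.1 (mlc l hα hα1).continuousOn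
    have i2 : IntervalIntegrable (fun s => (t - s) ^ (2 - α - 1) * (z s * z' s)) volume 0 t := by
      have := beta_intble' hα1 hq ht.1 (hzc.mul (mlc l hα hα1)).continuousOn
      refine this.congr (fun s _ => ?_)
      simp only [hz', F, Pi.mul_apply]; ring
    have h3 : ∫ s in (0:ℝ)..t, (t - s) ^ (2 - α - 1) * ((z t - z s) * z' s) =
        z t * (∫ s in (0:ℝ)..t, (t - s) ^ (2 - α - 1) * z' s) -
        ∫ s in (0:ℝ)..t, (t - s) ^ (2 - α - 1) * (z s * z' s) := by
      rw [← intervalIntegral.integral_const_mul, ← intervalIntegral.integral_sub (i1.const_mul _) i2]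
      congr 1; ext s; ring
    rw [h3, h2] at h1
    linarith
  have hmono : ∫ t in (0:ℝ)..T, ∫ s in (0:ℝ)..t, (t - s) ^ (2 - α - 1) * (z s * z' s) ≤
      ∫ t in (0:ℝ)..T, Real.Gamma (2 - α) * (z t * y t) := by
    rw [intervalIntegral.integral_of_le hT.le, intervalIntegral.integral_of_le hT.le]
    refine setIntegral_mono_on hKi ?_ measurableSet_Ioc hpt
    exact (by fun_prop : Continuous fun t => Real.Gamma (2 - α) * (z t * y t)).integrableOn_Ioc
  rw [hKv, intervalIntegral.integral_const_mul] at hmono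
  -- integration by parts
  have iA : IntervalIntegrable (fun s => (T - s) ^ (2 - α - 1) * z s ^ 2) volume 0 T := by
    have := beta_intble' (p := 1) one_pos hq hT (hzc.pow 2).continuousOn
    simpa using this
  have hpc : Continuous fun s : ℝ => (T - s) ^ (2 - α) :=
      (Real.continuous_rpow_const hq.le).comp (by fun_prop)
  have iB : IntervalIntegrable (fun s => (T - s) ^ (2 - α) / (2 - α) * (z s * z' s)) volume 0 T := by
    rw [intervalIntegrable_iff_integrableOn_Icc_of_le hT.le]
    rw [← integrableOn_Icc_iff_integrableOn_Ioc] at hff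
    exact hff.continuousOn_mul (hpc.div_const _).continuousOn isCompact_Icc
  have hparts : ∫ s in (0:ℝ)..T, ((T - s) ^ (2 - α) / (2 - α) * (z s * z' s) -
      (1/2) * ((T - s) ^ (2 - α - 1) * z s ^ 2)) = 0 := by
    rw [intervalIntegral.integral_eq_sub_of_hasDerivAt_of_le
      (f := fun s => (T - s) ^ (2 - α) * z s ^ 2 / (2 * (2 - α))) hT.le
      ((hpc.mul (hzc.pow 2)).div_const _).continuousOn ?_ (iB.sub (iA.const_mul _))]
    · simp [hz0, Real.zero_rpow hq.ne']
    · intro s hs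
      have hs1 : 0 < T - s := by linarith [hs.2]
      have hA : HasDerivAt (fun s => (T - s) ^ (2 - α))
          ((-1) * (2 - α) * (T - s) ^ (2 - α - 1)) s :=
        ((hasDerivAt_id s).const_sub T).rpow_const (Or.inl hs1.ne')
      have := (hA.mul ((hzd s hs.1).fun_pow 2)).div_const (2 * (2 - α))
      refine HasDerivAt.congr_deriv this ?_
      push_cast
      field_simp
      ring
  rw [intervalIntegral.integral_sub iB (iA.const_mul _), intervalIntegral.integral_const_mul] at hparts
  have e1 : 1 - y T ^ 2 = 2 * l * ∫ x in (0:ℝ)..T, z x * y x := by linarith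
  rw [e1]
  have e2 := mul_le_mul_of_nonneg_left hmono hl.le
  have e3 : l * ∫ s in (0:ℝ)..T, (T - s) ^ (2 - α - 1) * z s ^ 2 =
      2 * (l * ∫ s in (0:ℝ)..T, (T - s) ^ (2 - α) / (2 - α) * (z s * z' s)) := by
    rw [show (∫ s in (0:ℝ)..T, (T - s) ^ (2 - α) / (2 - α) * (z s * z' s)) =
      1 / 2 * ∫ x in (0:ℝ)..T, (T - x) ^ (2 - α - 1) * z x ^ 2 by linarith]
    ring
  rw [e3]
  linarith

end RLproof

namespace RLproof

section hilbert

variable {H : Type*} [NormedAddCommGroup H] [InnerProductSpace ℝ H] [CompleteSpace H]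

lemma hilb_hasSum (e : HilbertBasis ℕ ℝ H) {c : ℕ → ℝ} (hc : Summable fun n => c n ^ 2) :
    Summable (fun n => c n • e n) ∧ (∀ m, ⟪e m, ∑' n, c n • e n⟫ = c m) ∧
      ‖∑' n, c n • e n‖ ^ 2 = ∑' n, c n ^ 2 := by
  have hm : Memℓp c 2 := by
    apply memℓp_gen
    simpa using hc
  set f : lp (fun _ : ℕ => ℝ) 2 := ⟨c, hm⟩ with hf
  have hs : HasSum (fun n => c n • e n) (e.repr.symm f) := e.hasSum_repr_symm f
  have hi : ∀ m, ⟪e m, ∑' n, c n • e n⟫ = c m := by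
    intro m
    rw [hs.tsum_eq, ← e.repr_apply_apply]
    simp [hf]
  refine ⟨hs.summable, hi, ?_⟩
  rw [← real_inner_self_eq_norm_sq, ← e.tsum_inner_mul_inner]
  refine tsum_congr fun n => ?_
  rw [real_inner_comm, hi]
  ring

lemma hilb_cont (e : HilbertBasis ℕ ℝ H) {c : ℕ → ℝ → ℝ} {B : ℕ → ℝ} {S : Set ℝ}
    (hB : Summable fun n => B n ^ 2) (hc : ∀ n, ContinuousOn (c n) S)
    (hcB : ∀ n, ∀ t ∈ S, |c n t| ≤ B n) :
    ContinuousOn (fun t => ∑' n, c n t • e n) S := by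
  have hsq : ∀ n, ∀ t ∈ S, c n t ^ 2 ≤ B n ^ 2 := fun n t ht =>
    sq_le_sq.2 ((hcB n t ht).trans (le_abs_self _))
  have hsum : ∀ t ∈ S, Summable fun n => c n t ^ 2 := fun t ht =>
    Summable.of_nonneg_of_le (fun n => sq_nonneg _) (fun n => hsq n t ht) hB
  intro t₀ ht₀
  have hdiff : ∀ n, ∀ t ∈ S, (c n t - c n t₀) ^ 2 ≤ 4 * B n ^ 2 := by
    intro n t ht
    have h1 := hsq n t ht
    have h2 := hsq n t₀ ht₀
    nlinarith [sq_nonneg (c n t + c n t₀)]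
  have hdom : Tendsto (fun t => ∑' n, (c n t - c n t₀) ^ 2) (𝓝[S] t₀) (𝓝 (∑' _ : ℕ, (0:ℝ))) := by
    refine tendsto_tsum_of_dominated_convergence (hB.mul_left 4) ?_ ?_
    · intro n
      have := ((hc n t₀ ht₀).tendsto.sub_const (c n t₀)).pow 2
      simpa using this
    · filter_upwards [self_mem_nhdsWithin] with t ht n
      rw [Real.norm_of_nonneg (sq_nonneg _)]
      exact hdiff n t ht
  rw [tsum_zero] at hdom
  rw [ContinuousWithinAt, tendsto_iff_norm_sub_tendsto_zero]
  have h2 := hdom.sqrt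
  rw [Real.sqrt_zero] at h2
  refine h2.congr' ?_
  filter_upwards [self_mem_nhdsWithin] with t ht
  rw [← (hilb_hasSum e (hsum t ht)).1.tsum_sub (hilb_hasSum e (hsum t₀ ht₀)).1]
  simp_rw [← sub_smul]
  have hs : Summable fun n => (c n t - c n t₀) ^ 2 :=
    Summable.of_nonneg_of_le (fun n => sq_nonneg _) (fun n => hdiff n t ht) (hB.mul_left 4)
  rw [← (hilb_hasSum e hs).2.2, Real.sqrt_sq (norm_nonneg _)]

lemma hilb_int (e : HilbertBasis ℕ ℝ H) {μ : Measure ℝ} {w : ℝ → ℝ} {D : ℕ → ℝ → ℝ}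
    {M : ℕ → ℝ} (hw : Integrable w μ) (hwp : ∀ᵐ s ∂μ, 0 < w s)
    (hD : ∀ n, AEStronglyMeasurable (D n) μ)
    (hDi : ∀ n, Integrable (fun s => w s * D n s ^ 2) μ)
    (hDM : ∀ n, ∫ s, w s * D n s ^ 2 ∂μ ≤ M n) (hM : Summable M) :
    (∀ᵐ s ∂μ, Summable fun n => D n s ^ 2) ∧
      Integrable (fun s => w s • ∑' n, D n s • e n) μ := by
  have hnn : ∀ n, 0 ≤ᵐ[μ] fun s => w s * D n s ^ 2 := by
    intro n
    filter_upwards [hwp] with s hs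
    positivity
  have hfin : ∫⁻ s, ∑' n, ENNReal.ofReal (w s * D n s ^ 2) ∂μ ≠ ⊤ := by
    rw [lintegral_tsum (fun n => (hDi n).1.aemeasurable.ennreal_ofReal)]
    refine ne_top_of_le_ne_top hM.tsum_ofReal_ne_top (ENNReal.tsum_le_tsum fun n => ?_)
    rw [← ofReal_integral_eq_lintegral_ofReal (hDi n) (hnn n)]
    exact ENNReal.ofReal_le_ofReal (hDM n)
  have hmeas : AEMeasurable (fun s => ∑' n, ENNReal.ofReal (w s * D n s ^ 2)) μ :=
    AEMeasurable.tsum fun n => (hDi n).1.aemeasurable.ennreal_ofReal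
  have hsw : ∀ᵐ s ∂μ, Summable fun n => w s * D n s ^ 2 := by
    filter_upwards [ae_lt_top' hmeas hfin, hwp] with s hs hp
    have := ENNReal.summable_toReal hs.ne
    refine this.congr fun n => ?_
    rw [ENNReal.toReal_ofReal (by positivity)]
  have hs : ∀ᵐ s ∂μ, Summable fun n => D n s ^ 2 := by
    filter_upwards [hsw, hwp] with s hs hp
    exact (summable_mul_left_iff hp.ne').1 hs
  refine ⟨hs, ?_, ?_⟩
  · refine hw.1.smul ?_
    refine aestronglyMeasurable_of_tendsto_ae atTop
      (f := fun N s => ∑ n ∈ Finset.range N, D n s • e n) ?_ ?_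
    · intro N
      refine Finset.aestronglyMeasurable_fun_sum _ fun n _ => (hD n).smul_const _
    · filter_upwards [hs] with s hs
      exact (hilb_hasSum e hs).1.hasSum.tendsto_sum_nat
  · have hle : ∫⁻ s, ‖w s • ∑' n, D n s • e n‖ₑ ∂μ ≤
        ∫⁻ s, (‖w s‖ₑ + ∑' n, ENNReal.ofReal (w s * D n s ^ 2)) ∂μ := by
      refine lintegral_mono_ae ?_
      filter_upwards [hs, hsw, hwp] with s hs hsw hp
      rw [← ENNReal.ofReal_tsum_of_nonneg (fun n => by positivity) hsw, tsum_mul_left,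
        ← (hilb_hasSum e hs).2.2, ← ofReal_norm_eq_enorm, ← ofReal_norm_eq_enorm,
        ← ENNReal.ofReal_add (by positivity) (by positivity)]
      apply ENNReal.ofReal_le_ofReal
      rw [norm_smul, Real.norm_of_nonneg hp.le]
      nlinarith [sq_nonneg (‖∑' n, D n s • e n‖ - 1), sq_nonneg (‖∑' n, D n s • e n‖)]
    refine lt_of_le_of_lt hle ?_
    rw [lintegral_add_right' _ hmeas]
    exact ENNReal.add_lt_top.2 ⟨hw.2, hfin.lt_top⟩

end hilbert

/-- coefficient functions -/
noncomputable def Dn (α l a b s : ℝ) : ℝ := -(l * a * F α l α s) + b * F α l 1 s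

lemma W_int {α t : ℝ} (hα2 : α < 2) (ht : 0 < t) :
    ∫ s in (0:ℝ)..t, (t - s) ^ (2 - α - 1) = t ^ (2 - α) / (2 - α) := by
  have hq : 0 < 2 - α := by linarith
  have := beta_int (p := 1) one_pos hq ht
  simp only [sub_self, Real.rpow_zero, mul_one, Real.Gamma_one] at this
  rw [this, add_comm 1, Real.Gamma_add_one hq.ne', add_sub_cancel_right]
  have := (Real.Gamma_pos_of_pos hq).ne'
  field_simp

lemma w_cont_int {α t : ℝ} (hα2 : α < 2) (ht : 0 < t) {h : ℝ → ℝ} (hh : Continuous h) :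
    IntervalIntegrable (fun s => (t - s) ^ (2 - α - 1) * h s) volume 0 t := by
  have := beta_intble' (p := 1) (q := 2 - α) one_pos (by linarith) ht hh.continuousOn
  simpa using this

lemma y_le {α l t : ℝ} (hα : 1 < α) (hα2 : α < 2) (hl : 0 < l) (ht : 0 < t) :
    (F α l 1 t) ^ 2 ≤ 1 := by
  have h := energy hα hα2 hl ht
  have h0 : 0 ≤ ∫ s in (0:ℝ)..t, (t - s) ^ (2 - α - 1) * (F α l α s) ^ 2 := by
    refine intervalIntegral.integral_nonneg ht.le fun s hs => ?_
    exact mul_nonneg (Real.rpow_nonneg (by linarith [hs.2]) _) (sq_nonneg _)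
  have hG := Real.Gamma_pos_of_pos (show 0 < 2 - α by linarith)
  have : 0 ≤ Real.Gamma (2 - α) * (1 - (F α l 1 t) ^ 2) := (mul_nonneg hl.le h0).trans h
  have := nonneg_of_mul_nonneg_right this hG
  linarith

lemma energy' {α l T : ℝ} (hα : 1 < α) (hα2 : α < 2) (hl : 0 < l) (hT : 0 < T) :
    l * ∫ s in (0:ℝ)..T, (T - s) ^ (2 - α - 1) * (F α l α s) ^ 2 ≤ Real.Gamma (2 - α) := by
  have h := energy hα hα2 hl hT
  have hG := Real.Gamma_pos_of_pos (show 0 < 2 - α by linarith)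
  nlinarith [mul_nonneg hG.le (sq_nonneg (F α l 1 T))]

lemma Dn_cont {α l a b : ℝ} (hα : 1 < α) : Continuous (Dn α l a b) := by
  have h1 : Continuous (F α l α) := F_cont hα hα.le
  have h2 : Continuous (F α l 1) := F_cont hα le_rfl
  unfold Dn
  fun_prop

lemma Dn_sq {α l a b t : ℝ} (hα : 1 < α) (hα2 : α < 2) (hl : 0 < l) (ht : 0 < t) :
    ∫ s in (0:ℝ)..t, (t - s) ^ (2 - α - 1) * (Dn α l a b s) ^ 2 ≤
      2 * Real.Gamma (2 - α) * (l * a ^ 2) + 2 * (t ^ (2 - α) / (2 - α)) * b ^ 2 := by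
  have h1 : Continuous (F α l α) := F_cont hα hα.le
  have h2 : Continuous (F α l 1) := F_cont hα le_rfl
  have i1 : IntervalIntegrable (fun s => (t - s) ^ (2 - α - 1) * (F α l α s) ^ 2) volume 0 t := w_cont_int hα2 ht (h1.pow 2)
  have i0 : IntervalIntegrable (fun s => (t - s) ^ (2 - α - 1)) volume 0 t := by
    simpa using w_cont_int hα2 ht (continuous_const (y := (1:ℝ)))
  calc _ ≤ ∫ s in (0:ℝ)..t, (2 * l ^ 2 * a ^ 2 * ((t - s) ^ (2 - α - 1) * (F α l α s) ^ 2) +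
          2 * b ^ 2 * (t - s) ^ (2 - α - 1)) := by
        refine intervalIntegral.integral_mono_on_of_le_Ioo ht.le
          (w_cont_int hα2 ht ((Dn_cont hα).pow 2)) ((i1.const_mul _).add (i0.const_mul _)) ?_
        intro s hs
        have hw : 0 ≤ (t - s) ^ (2 - α - 1) := Real.rpow_nonneg (by linarith [hs.2]) _
        have hy := y_le hα hα2 hl hs.1
        have : (Dn α l a b s) ^ 2 ≤ 2 * l ^ 2 * a ^ 2 * (F α l α s) ^ 2 + 2 * b ^ 2 := by
          unfold Dn
          nlinarith [sq_nonneg (l * a * F α l α s + b * F α l 1 s),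
            mul_le_mul_of_nonneg_left hy (sq_nonneg b)]
        nlinarith [mul_le_mul_of_nonneg_left this hw]
    _ = 2 * l * a ^ 2 * (l * ∫ s in (0:ℝ)..t, (t - s) ^ (2 - α - 1) * (F α l α s) ^ 2) +
          2 * b ^ 2 * (t ^ (2 - α) / (2 - α)) := by
        rw [intervalIntegral.integral_add (i1.const_mul _) (i0.const_mul _),
          intervalIntegral.integral_const_mul, intervalIntegral.integral_const_mul, W_int hα2 ht]
        ring
    _ ≤ _ := by
        have := mul_le_mul_of_nonneg_left (energy' hα hα2 hl ht)
          (show 0 ≤ 2 * l * a ^ 2 by positivity)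
        linarith

lemma Dn_abs {α l a b t : ℝ} (hα : 1 < α) (hα2 : α < 2) (hl : 0 < l) (ht : 0 < t) :
    |∫ s in (0:ℝ)..t, (t - s) ^ (2 - α - 1) * (Dn α l a b s - b)| ≤
      (Real.sqrt l * |a|) * (t ^ (2 - α) / (2 - α) + Real.Gamma (2 - α)) / 2
        + 2 * (t ^ (2 - α) / (2 - α)) * |b| := by
  have h1 : Continuous (F α l α) := F_cont hα hα.le
  have i1 : IntervalIntegrable (fun s => (t - s) ^ (2 - α - 1) * (F α l α s) ^ 2) volume 0 t := w_cont_int hα2 ht (h1.pow 2)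
  have i0 : IntervalIntegrable (fun s => (t - s) ^ (2 - α - 1)) volume 0 t := by
    simpa using w_cont_int hα2 ht (continuous_const (y := (1:ℝ)))
  have hDb : Continuous fun s => Dn α l a b s - b := (Dn_cont hα).sub continuous_const
  have hsq : Real.sqrt l * Real.sqrt l = l := Real.mul_self_sqrt hl.le
  have hsp : 0 ≤ Real.sqrt l := Real.sqrt_nonneg l
  calc _ ≤ ∫ s in (0:ℝ)..t, |(t - s) ^ (2 - α - 1) * (Dn α l a b s - b)| :=
        intervalIntegral.abs_integral_le_integral_abs ht.le
    _ ≤ ∫ s in (0:ℝ)..t, ((Real.sqrt l * |a| / 2 * l) * ((t - s) ^ (2 - α - 1) * (F α l α s) ^ 2) +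
          (Real.sqrt l * |a| / 2 + 2 * |b|) * (t - s) ^ (2 - α - 1)) := by
        refine intervalIntegral.integral_mono_on_of_le_Ioo ht.le
          (w_cont_int hα2 ht hDb).abs ((i1.const_mul _).add (i0.const_mul _)) ?_
        intro s hs
        have hw : 0 ≤ (t - s) ^ (2 - α - 1) := Real.rpow_nonneg (by linarith [hs.2]) _
        have hy : |F α l 1 s| ≤ 1 := by
          have := y_le hα hα2 hl hs.1
          exact (sq_le_one_iff_abs_le_one _).1 this
        have hz : Real.sqrt l * |F α l α s| ≤ (1 + l * (F α l α s) ^ 2) / 2 := by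
          have := sq_nonneg (Real.sqrt l * |F α l α s| - 1)
          rw [sub_sq, mul_pow, sq_abs, sq (Real.sqrt l), hsq] at this
          linarith
        have hD : |Dn α l a b s - b| ≤
            Real.sqrt l * |a| * ((1 + l * (F α l α s) ^ 2) / 2) + 2 * |b| := by
          have e1 : Dn α l a b s - b = -(l * a * F α l α s) + b * (F α l 1 s - 1) := by
            unfold Dn; ring
          rw [e1]
          refine (abs_add_le _ _).trans ?_
          have e2 : |-(l * a * F α l α s)| = (Real.sqrt l * |a|) * (Real.sqrt l * |F α l α s|) := by
            rw [abs_neg, abs_mul, abs_mul, abs_of_pos hl]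
            calc _ = (Real.sqrt l * Real.sqrt l) * |a| * |F α l α s| := by rw [hsq]
              _ = _ := by ring
          have e3 : |b * (F α l 1 s - 1)| ≤ 2 * |b| := by
            rw [abs_mul, mul_comm 2]
            refine mul_le_mul_of_nonneg_left ?_ (abs_nonneg _)
            rw [abs_le] at hy ⊢
            constructor <;> linarith [hy.1, hy.2]
          rw [e2]
          exact add_le_add (mul_le_mul_of_nonneg_left hz (by positivity)) e3
        rw [abs_mul, abs_of_nonneg hw]
        refine (mul_le_mul_of_nonneg_left hD hw).trans (le_of_eq ?_)
        ring
    _ = (Real.sqrt l * |a| / 2) * (l * ∫ s in (0:ℝ)..t, (t - s) ^ (2 - α - 1) * (F α l α s) ^ 2) +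
          (Real.sqrt l * |a| / 2 + 2 * |b|) * (t ^ (2 - α) / (2 - α)) := by
        rw [intervalIntegral.integral_add (i1.const_mul _) (i0.const_mul _),
          intervalIntegral.integral_const_mul, intervalIntegral.integral_const_mul, W_int hα2 ht]
        ring
    _ ≤ _ := by
        have := mul_le_mul_of_nonneg_left (energy' hα hα2 hl ht)
          (show 0 ≤ Real.sqrt l * |a| / 2 by positivity)
        linarith

lemma Dn_val {α l a b t : ℝ} (hα : 1 < α) (hα2 : α < 2) (ht : 0 < t) :
    ∫ s in (0:ℝ)..t, (t - s) ^ (2 - α - 1) * (Dn α l a b s - b) =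
      Real.Gamma (2 - α) * -(l * (a * (t * ML α 2 (-(l * t ^ α))) +
        b * (t ^ 2 * ML α 3 (-(l * t ^ α))))) := by
  have hq : 0 < 2 - α := by linarith
  have h1 : Continuous (F α l α) := F_cont hα hα.le
  have h2 : Continuous (F α l 1) := F_cont hα le_rfl
  have i1 := w_cont_int hα2 ht h1
  have i2 := w_cont_int hα2 ht h2
  have i0 : IntervalIntegrable (fun s => (t - s) ^ (2 - α - 1)) volume 0 t := by
    simpa using w_cont_int hα2 ht (continuous_const (y := (1:ℝ)))
  have e1 := F_int (l := l) hα (show 0 < α by linarith) hq ht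
  have e2 := F_int (l := l) hα one_pos hq ht
  rw [show α + (2 - α) = 2 by ring] at e1
  rw [F_rec hα (by linarith) ht, show 1 + (2 - α) + α = 3 by ring, add_comm 1 (2 - α),
    add_sub_cancel_right, Real.Gamma_add_one hq.ne'] at e2
  have e3 : F α l 2 t = t * ML α 2 (-(l * t ^ α)) := by
    rw [F, show (2:ℝ) - 1 = 1 by norm_num, Real.rpow_one]
  have e4 : F α l 3 t = t ^ 2 * ML α 3 (-(l * t ^ α)) := by
    rw [F, show (3:ℝ) - 1 = 2 by norm_num, Real.rpow_two]
  have hsplit : ∫ s in (0:ℝ)..t, (t - s) ^ (2 - α - 1) * (Dn α l a b s - b) =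
      (-(l * a)) * (∫ s in (0:ℝ)..t, (t - s) ^ (2 - α - 1) * F α l α s) +
      b * (∫ s in (0:ℝ)..t, (t - s) ^ (2 - α - 1) * F α l 1 s) -
      b * (∫ s in (0:ℝ)..t, (t - s) ^ (2 - α - 1)) := by
    rw [← intervalIntegral.integral_const_mul, ← intervalIntegral.integral_const_mul,
      ← intervalIntegral.integral_const_mul,
      ← intervalIntegral.integral_add (i1.const_mul _) (i2.const_mul _),
      ← intervalIntegral.integral_sub ((i1.const_mul _).add (i2.const_mul _)) (i0.const_mul _)]
    congr 1; ext s; unfold Dn; ring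
  rw [hsplit, e1, e2, W_int hα2 ht, ← e3, ← e4]
  have := (Real.Gamma_pos_of_pos hq).ne'
  field_simp
  ring

end RLproof

theorem riemannLiouville_of_series_derivative {H : Type*} [NormedAddCommGroup H]
    [InnerProductSpace ℝ H] [CompleteSpace H]
    (e : HilbertBasis ℕ ℝ H) (lam : ℕ → ℝ) (hlam : ∀ n, 0 < lam n)
    (hlamT : Filter.Tendsto lam Filter.atTop Filter.atTop)
    (α T : ℝ) (hα1 : 1 < α) (hα2 : α < 2) (hT : 0 < T)
    (u₀ u₁ : H) (hu₀ : Summable fun n => lam n * ⟪u₀, e n⟫ ^ 2) :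
    let d : ℕ → ℝ → ℝ := fun n t =>
      -(lam n * ⟪u₀, e n⟫ * (t ^ (α - 1) * ML α α (-(lam n * t ^ α)))) +
        ⟪u₁, e n⟫ * ML α 1 (-(lam n * t ^ α))
    (∀ t ∈ Set.Icc (0 : ℝ) T,
      riemannLiouville (2 - α) (fun s => (∑' n, d n s • e n) - u₁) t =
        -∑' n, (lam n * (⟪u₀, e n⟫ * (t * ML α 2 (-(lam n * t ^ α))) +
            ⟪u₁, e n⟫ * (t ^ 2 * ML α 3 (-(lam n * t ^ α))))) • e n) ∧
    ContinuousOn (fun t => riemannLiouville (2 - α) (fun s => (∑' n, d n s • e n) - u₁) t)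
      (Set.Icc (0 : ℝ) T) := by
  intro d
  have hq : 0 < 2 - α := by linarith
  have hG := Real.Gamma_pos_of_pos hq
  have hd : ∀ n s, d n s = RLproof.Dn α (lam n) ⟪u₀, e n⟫ ⟪u₁, e n⟫ s := by
    intro n s
    simp [d, RLproof.Dn, RLproof.F]
  have hb : Summable fun n => ⟪u₁, e n⟫ ^ 2 := by
    refine (e.summable_inner_mul_inner u₁ u₁).congr fun n => ?_
    rw [real_inner_comm u₁ (e n)]
    ring
  set c : ℕ → ℝ → ℝ := fun n t => lam n * (⟪u₀, e n⟫ * (t * ML α 2 (-(lam n * t ^ α))) +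
            ⟪u₁, e n⟫ * (t ^ 2 * ML α 3 (-(lam n * t ^ α)))) with hc
  have hval : ∀ t ∈ Set.Icc (0 : ℝ) T,
      riemannLiouville (2 - α) (fun s => (∑' n, d n s • e n) - u₁) t = -∑' n, c n t • e n := by
    intro t ht
    rcases ht.1.eq_or_lt with rfl | ht0
    · simp [riemannLiouville, hc]
    have hwc : IntegrableOn (fun s => (t - s) ^ (2 - α - 1)) (Ioc 0 t) := by
      rw [← intervalIntegrable_iff_integrableOn_Ioc_of_le ht0.le]
      simpa using RLproof.w_cont_int hα2 ht0 (continuous_const (y := (1:ℝ)))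
    have hwp : ∀ᵐ s ∂(volume.restrict (Ioc 0 t)), 0 < (t - s) ^ (2 - α - 1) := by
      rw [← restrict_Ioo_eq_restrict_Ioc]
      filter_upwards [ae_restrict_mem measurableSet_Ioo] with s hs
      exact Real.rpow_pos_of_pos (by linarith [hs.2]) _
    have hdc : ∀ n, Continuous (d n) := by
      intro n
      rw [show d n = _ from funext (hd n)]
      exact RLproof.Dn_cont hα1
    obtain ⟨hae, hIntg⟩ := RLproof.hilb_int e (μ := volume.restrict (Ioc 0 t))
      (w := fun s => (t - s) ^ (2 - α - 1)) (D := d)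
      (M := fun n => 2 * Real.Gamma (2 - α) * (lam n * ⟪u₀, e n⟫ ^ 2) +
        2 * (t ^ (2 - α) / (2 - α)) * ⟪u₁, e n⟫ ^ 2) hwc hwp
      (fun n => (hdc n).aestronglyMeasurable)
      (fun n => by
        have := RLproof.w_cont_int hα2 ht0 ((hdc n).pow 2)
        rwa [intervalIntegrable_iff_integrableOn_Ioc_of_le ht0.le] at this)
      (fun n => by
        rw [← intervalIntegral.integral_of_le ht0.le]
        simp_rw [hd]
        exact RLproof.Dn_sq hα1 hα2 (hlam n) ht0)
      ((hu₀.mul_left _).add (hb.mul_left _))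
    have hIntg2 : Integrable (fun s => (t - s) ^ (2 - α - 1) • ((∑' n, d n s • e n) - u₁))
        (volume.restrict (Ioc 0 t)) := by
      simp_rw [smul_sub]
      exact hIntg.sub (hwc.smul_const u₁)
    set v := riemannLiouville (2 - α) (fun s => (∑' n, d n s • e n) - u₁) t with hv
    have hcoef : ∀ m, e.repr v m = -c m t := by
      intro m
      rw [e.repr_apply_apply, hv, riemannLiouville, inner_smul_right,
        intervalIntegral.integral_of_le ht0.le, ← integral_inner hIntg2]
      have : ∫ s in Ioc 0 t, ⟪e m, (t - s) ^ (2 - α - 1) • ((∑' n, d n s • e n) - u₁)⟫ =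
          ∫ s in (0:ℝ)..t, (t - s) ^ (2 - α - 1) *
            (RLproof.Dn α (lam m) ⟪u₀, e m⟫ ⟪u₁, e m⟫ s - ⟪u₁, e m⟫) := by
        rw [intervalIntegral.integral_of_le ht0.le]
        refine integral_congr_ae ?_
        filter_upwards [hae] with s hs
        rw [inner_smul_right, inner_sub_right, (RLproof.hilb_hasSum e hs).2.1, hd,
          real_inner_comm u₁ (e m)]
      rw [this, RLproof.Dn_val hα1 hα2 ht0, ← mul_assoc, inv_mul_cancel₀ hG.ne', one_mul]
    rw [← tsum_neg, ← (e.hasSum_repr v).tsum_eq]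
    refine tsum_congr fun m => ?_
    rw [hcoef, neg_smul]
  refine ⟨hval, ?_⟩
  refine ContinuousOn.congr (ContinuousOn.neg ?_) hval
  set W := T ^ (2 - α) / (2 - α) with hW
  have hW0 : 0 ≤ W := by positivity
  set C1 := (Real.Gamma (2 - α))⁻¹ * ((W + Real.Gamma (2 - α)) / 2) with hC1
  set C2 := (Real.Gamma (2 - α))⁻¹ * (2 * W) with hC2
  refine RLproof.hilb_cont e
    (B := fun n => C1 * (Real.sqrt (lam n) * |⟪u₀, e n⟫|) + C2 * |⟪u₁, e n⟫|) ?_ ?_ ?_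
  · refine Summable.of_nonneg_of_le (fun n => sq_nonneg _) (fun n => ?_)
      ((hu₀.mul_left (2 * C1 ^ 2)).add (hb.mul_left (2 * C2 ^ 2)))
    have h1 : (Real.sqrt (lam n) * |⟪u₀, e n⟫|) ^ 2 = lam n * ⟪u₀, e n⟫ ^ 2 := by
      rw [mul_pow, Real.sq_sqrt (hlam n).le, sq_abs]
    have h2 : |⟪u₁, e n⟫| ^ 2 = ⟪u₁, e n⟫ ^ 2 := sq_abs _
    rw [← h1, ← h2]
    nlinarith [sq_nonneg (C1 * (Real.sqrt (lam n) * |⟪u₀, e n⟫|) - C2 * |⟪u₁, e n⟫|)]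
  · intro n
    have h2 := RLproof.mlc (β := 2) (lam n) hα1 (by norm_num)
    have h3 := RLproof.mlc (β := 3) (lam n) hα1 (by norm_num)
    simp only [hc]
    exact (by fun_prop : Continuous fun t : ℝ => lam n * (⟪u₀, e n⟫ * (t * ML α 2 (-(lam n * t ^ α))) +
            ⟪u₁, e n⟫ * (t ^ 2 * ML α 3 (-(lam n * t ^ α))))).continuousOn
  · intro n t ht
    rcases ht.1.eq_or_lt with rfl | ht0
    · simp only [hc]
      simp
      positivity
    have hv := RLproof.Dn_val (l := lam n) (a := ⟪u₀, e n⟫) (b := ⟪u₁, e n⟫) hα1 hα2 ht0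
    have hab := RLproof.Dn_abs (a := ⟪u₀, e n⟫) (b := ⟪u₁, e n⟫) hα1 hα2 (hlam n) ht0
    rw [hv, abs_mul, abs_of_pos hG, abs_neg] at hab
    have hWt : t ^ (2 - α) / (2 - α) ≤ W := by
      have := Real.rpow_le_rpow ht0.le ht.2 hq.le
      rw [hW]
      gcongr
    have hab2 := hab.trans (b := _) (c := (Real.sqrt (lam n) * |⟪u₀, e n⟫|) *
      (W + Real.Gamma (2 - α)) / 2 + 2 * W * |⟪u₁, e n⟫|) (by gcongr)
    have : |c n t| ≤ (Real.Gamma (2 - α))⁻¹ * ((Real.sqrt (lam n) * |⟪u₀, e n⟫|) *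
      (W + Real.Gamma (2 - α)) / 2 + 2 * W * |⟪u₁, e n⟫|) := by
      rw [le_inv_mul_iff₀ hG]
      exact hab2
    refine this.trans (le_of_eq ?_)
    rw [hC1, hC2]
    ring
end
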